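/- arXiv:2004.00729 — 9 statements merged into one kernel-verified Lean document; each statement's English description precedes it below -/
import Mathlib

section
/- Boundary value well-posedness (Shilnikov): Let s, u ≥ 1, let L⁻ and L⁺ be real symmetric matrices of sizes s×s and u×u respectively, and let λ, μ > 0 satisfy ⟪L⁻x, x⟫ ≤ -λ‖x‖² for all x ∈ ℝ^s and ⟪L⁺y, y⟫ ≥ μ‖y‖² for all y ∈ ℝ^u. Let F = (f, g) : ℝ^s × ℝ^u → ℝ^s × ℝ^u be C¹ with F(0,0) = 0 and DF(0,0) = 0, and let ε > 0 be such that sup over max(‖x‖,‖y‖) ≤ 2ε of (‖F(x,y)‖ + ‖DF(x,y)‖_op) < min(λ, μ). Then for every τ ≥ 0 and every (x₀, y₁) with max(‖x₀‖, ‖y₁‖) < ε there exists a C¹ pair (x, y) : [0,τ] → ℝ^s × ℝ^u satisfying x'(t) = L⁻x(t) + f(x(t), y(t)) and y'(t) = L⁺y(t) + g(x(t), y(t)) for all t ∈ [0,τ], with boundary conditions x(0) = x₀ and y(τ) = y₁, and satisfying max(‖x(t)‖, ‖y(t)‖) ≤ 2·max(‖x₀‖, ‖y₁‖) for all t ∈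 [0,τ]; moreover this solution is unique among C¹ solutions of the boundary value problem taking values in the set {(x,y) : max(‖x‖,‖y‖) ≤ 2ε}. -/
open Set
open scoped InnerProductSpace

/-- The continuous linear map on Euclidean space induced by a square real matrix. -/
noncomputable def matCLM {n : ℕ} (M : Matrix (Fin n) (Fin n) ℝ) :
    EuclideanSpace ℝ (Fin n) →L[ℝ] EuclideanSpace ℝ (Fin n) :=
  LinearMap.toContinuousLinearMap (Matrix.toEuclideanLin M)

section DissipativeLinear

variable {E : Type*} [NormedAddCommGroup E] [InnerProductSpace ℝ E] {A : E →L[ℝ] E} {c M r τ : ℝ}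
  {x h : ℝ → E}

/-- A solution of a forced linear equation with dissipative linear part never leaves a closed ball
that contains its initial value and whose radius is at least the forcing divided by the
dissipation rate. -/
theorem norm_le_of_dissipative (hc : 0 < c) (hA : ∀ v, ⟪A v, v⟫_ℝ ≤ -c * ‖v‖ ^ 2)
    (hx : ∀ t ∈ Icc 0 τ, HasDerivWithinAt x (A (x t) + h t) (Icc 0 τ) t)
    (hh : ∀ t ∈ Icc 0 τ, ‖h t‖ ≤ M) (h0 : ‖x 0‖ ≤ r) (hr : M ≤ c * r) :
    ∀ t ∈ Icc 0 τ, ‖x t‖ ≤ r := by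
  intro t ht
  refine le_of_forall_gt_imp_ge_of_dense fun R hR => ?_
  have hR0 : 0 < R := ((norm_nonneg _).trans h0).trans_lt hR
  have key := image_le_of_deriv_right_lt_deriv_boundary (f := fun t => ‖x t‖ ^ 2)
    (f' := fun t => 2 * ⟪x t, A (x t) + h t⟫_ℝ) (a := 0) (b := τ)
    (fun s hs => (hx s hs).norm_sq.continuousWithinAt)
    (fun s hs => (hx s (Ico_subset_Icc_self hs)).norm_sq.mono_of_mem_nhdsWithin
      (Icc_mem_nhdsGE_of_mem hs))
    (B := fun _ => R ^ 2) (B' := fun _ => 0)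
    (by gcongr; exact h0.trans hR.le) (fun s => hasDerivAt_const s _)
    (fun s hs hsR => by
      have hxs : ‖x s‖ = R := (pow_left_inj₀ (norm_nonneg _) hR0.le two_ne_zero).1 hsR
      have h1 := hA (x s)
      have h2 := real_inner_le_norm (x s) (h s)
      have h3 := hh s (Ico_subset_Icc_self hs)
      rw [real_inner_comm, hxs] at h1
      rw [hxs] at h2
      rw [inner_add_right]
      have h4 : ‖h s‖ < c * R := (h3.trans hr).trans_lt (by gcongr)
      have h5 : R * ‖h s‖ < R * (c * R) := by gcongr
      nlinarith)
    ht
  exact (pow_le_pow_iff_left₀ (norm_nonneg _) hR0.le two_ne_zero).1 key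

/-- The version of `norm_le_of_dissipative` for expanding linear parts, with the value prescribed
at the final time. -/
theorem norm_le_of_expanding (hc : 0 < c) (hA : ∀ v, c * ‖v‖ ^ 2 ≤ ⟪A v, v⟫_ℝ)
    (hx : ∀ t ∈ Icc 0 τ, HasDerivWithinAt x (A (x t) + h t) (Icc 0 τ) t)
    (hh : ∀ t ∈ Icc 0 τ, ‖h t‖ ≤ M) (h1 : ‖x τ‖ ≤ r) (hr : M ≤ c * r) :
    ∀ t ∈ Icc 0 τ, ‖x t‖ ≤ r := by
  have hmem : ∀ t ∈ Icc 0 τ, τ - t ∈ Icc 0 τ := fun t ht => ⟨by linarith [ht.2], by linarith [ht.1]⟩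
  have key := norm_le_of_dissipative (A := -A) (x := fun t => x (τ - t)) (h := fun t => -h (τ - t))
    (τ := τ) (M := M) (r := r) hc
    (fun v => by
      rw [neg_apply, inner_neg_left]
      linarith [hA v])
    (fun t ht => by
      have := (hx _ (hmem t ht)).scomp t (((hasDerivAt_id' t).const_sub τ).hasDerivWithinAt) hmem
      convert! this using 1
      simp [add_comm])
    (fun t ht => by simpa using hh _ (hmem t ht)) (by simpa using h1) hr
  intro t ht
  simpa using key _ (hmem t ht)

end DissipativeLinear

/-- Global solvability of forced linear equations, by variation of constants. -/
theorem exists_hasDerivAt_linear {E : Type*} [NormedAddCommGroup E] [NormedSpace ℝ E]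
    [CompleteSpace E] (A : E →L[ℝ] E) {h : ℝ → E} (hh : Continuous h) (t₀ : ℝ) (a : E) :
    ∃ x : ℝ → E, x t₀ = a ∧ ∀ t, HasDerivAt x (A (x t) + h t) t := by
  have hcont : Continuous fun s : ℝ => NormedSpace.exp (s • (-A)) (h s) :=
    (continuous_iff_continuousAt.2 fun s =>
      (hasDerivAt_exp_smul_const (-A) s).continuousAt).clm_apply hh
  have hinv : ∀ t : ℝ, NormedSpace.exp (t • A) * NormedSpace.exp (t • (-A)) = 1 := fun t => by
    let := NormedAlgebra.restrictScalars ℚ ℝ (E →L[ℝ] E)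
    rw [← NormedSpace.exp_add_of_commute (by
      rw [smul_neg]; exact (Commute.refl _).neg_right)]
    simp
  refine ⟨fun t => NormedSpace.exp (t • A) (NormedSpace.exp (t₀ • (-A)) a +
    ∫ s in t₀..t, NormedSpace.exp (s • (-A)) (h s)), ?_, fun t => ?_⟩
  · simpa using DFunLike.congr_fun (hinv t₀) a
  · have h1 := (hasDerivAt_exp_smul_const' A t).clm_apply
      ((intervalIntegral.integral_hasDerivAt_right (hcont.intervalIntegrable t₀ t)
        hcont.stronglyMeasurable.stronglyMeasurableAtFilter hcont.continuousAt).const_add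
        (NormedSpace.exp (t₀ • (-A)) a))
    have h2 := DFunLike.congr_fun (hinv t) (h t)
    simp only [mul_apply_eq_comp, one_apply_eq_self] at h1 h2
    rwa [h2] at h1

section BoundaryValueProblem

variable {E F : Type*} [NormedAddCommGroup E] [InnerProductSpace ℝ E]
  [NormedAddCommGroup F] [InnerProductSpace ℝ F]
  {A : E →L[ℝ] E} {B : F →L[ℝ] F} {c κ R τ : ℝ} {f : E × F → E} {g : E × F → F}

/-- Two solutions of forced boundary value problems with the same linear part and the same boundary
data are as close as their forcing terms, up to the factor `1 / c`. -/
theorem norm_sub_le_of_forcing {x x' : ℝ → E} {y y' : ℝ → F} {h h' : ℝ → E} {k k' : ℝ → F}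
    {D : ℝ} (hc : 0 < c) (hD : 0 ≤ D)
    (hA : ∀ v, ⟪A v, v⟫_ℝ ≤ -c * ‖v‖ ^ 2) (hB : ∀ v, c * ‖v‖ ^ 2 ≤ ⟪B v, v⟫_ℝ)
    (hx : ∀ t ∈ Icc 0 τ, HasDerivWithinAt x (A (x t) + h t) (Icc 0 τ) t)
    (hy : ∀ t ∈ Icc 0 τ, HasDerivWithinAt y (B (y t) + k t) (Icc 0 τ) t)
    (hx' : ∀ t ∈ Icc 0 τ, HasDerivWithinAt x' (A (x' t) + h' t) (Icc 0 τ) t)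
    (hy' : ∀ t ∈ Icc 0 τ, HasDerivWithinAt y' (B (y' t) + k' t) (Icc 0 τ) t)
    (h0 : x 0 = x' 0) (h1 : y τ = y' τ)
    (hh : ∀ t ∈ Icc 0 τ, ‖h t - h' t‖ ≤ c * D) (hk : ∀ t ∈ Icc 0 τ, ‖k t - k' t‖ ≤ c * D) :
    ∀ t ∈ Icc 0 τ, ‖(x t, y t) - (x' t, y' t)‖ ≤ D := by
  intro t ht
  refine max_le ?_ ?_
  · refine norm_le_of_dissipative (x := fun t => x t - x' t) (h := fun t => h t - h' t) hc hA
      (fun s hs => ?_) hh (by simpa [h0] using hD) le_rfl t ht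
    convert! (hx s hs).sub (hx' s hs) using 1
    rw [map_sub]; abel
  · refine norm_le_of_expanding (x := fun t => y t - y' t) (h := fun t => k t - k' t) hc hB
      (fun s hs => ?_) hk (by simpa [h1] using hD) le_rfl t ht
    convert! (hy s hs).sub (hy' s hs) using 1
    rw [map_sub]; abel

/-- A boundary value problem has at most one solution inside a closed ball on which the nonlinearity
has Lipschitz constant less than `c`. -/
theorem bvp_unique {x x' : ℝ → E} {y y' : ℝ → F} (hc : 0 < c) (hκ : 0 ≤ κ) (hκc : κ < c)
    (hA : ∀ v, ⟪A v, v⟫_ℝ ≤ -c * ‖v‖ ^ 2) (hB : ∀ v, c * ‖v‖ ^ 2 ≤ ⟪B v, v⟫_ℝ)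
    (hf : ∀ p ∈ Metric.closedBall 0 R, ∀ q ∈ Metric.closedBall 0 R, ‖f p - f q‖ ≤ κ * ‖p - q‖)
    (hg : ∀ p ∈ Metric.closedBall 0 R, ∀ q ∈ Metric.closedBall 0 R, ‖g p - g q‖ ≤ κ * ‖p - q‖)
    (hx : ∀ t ∈ Icc 0 τ, HasDerivWithinAt x (A (x t) + f (x t, y t)) (Icc 0 τ) t)
    (hy : ∀ t ∈ Icc 0 τ, HasDerivWithinAt y (B (y t) + g (x t, y t)) (Icc 0 τ) t)
    (hx' : ∀ t ∈ Icc 0 τ, HasDerivWithinAt x' (A (x' t) + f (x' t, y' t)) (Icc 0 τ) t)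
    (hy' : ∀ t ∈ Icc 0 τ, HasDerivWithinAt y' (B (y' t) + g (x' t, y' t)) (Icc 0 τ) t)
    (h0 : x 0 = x' 0) (h1 : y τ = y' τ)
    (hR : ∀ t ∈ Icc 0 τ, (x t, y t) ∈ Metric.closedBall 0 R)
    (hR' : ∀ t ∈ Icc 0 τ, (x' t, y' t) ∈ Metric.closedBall 0 R) :
    ∀ t ∈ Icc 0 τ, x t = x' t ∧ y t = y' t := by
  intro t ht
  have hcont : ContinuousOn (fun t => ‖(x t, y t) - (x' t, y' t)‖) (Icc 0 τ) := fun s hs =>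
    (((hx s hs).continuousWithinAt.prodMk (hy s hs).continuousWithinAt).sub
      ((hx' s hs).continuousWithinAt.prodMk (hy' s hs).continuousWithinAt)).norm
  obtain ⟨s, hs, hmax⟩ := isCompact_Icc.exists_isMaxOn ⟨t, ht⟩ hcont
  set D := ‖(x s, y s) - (x' s, y' s)‖ with hDdef
  have hD : 0 ≤ D := norm_nonneg _
  have hmul : c * (κ / c * D) = κ * D := by field_simp
  have hle : D ≤ κ / c * D := norm_sub_le_of_forcing hc (by positivity) hA hB hx hy hx' hy' h0 h1
    (fun r hr => hmul ▸ (hf _ (hR r hr) _ (hR' r hr)).trans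
      (mul_le_mul_of_nonneg_left (hmax hr) hκ))
    (fun r hr => hmul ▸ (hg _ (hR r hr) _ (hR' r hr)).trans
      (mul_le_mul_of_nonneg_left (hmax hr) hκ)) s hs
  have hlt : κ / c < 1 := (div_lt_one hc).2 hκc
  have hD0 : D ≤ 0 := by nlinarith
  have ht0 : (x t, y t) - (x' t, y' t) = 0 := norm_le_zero_iff.1 ((hmax ht).trans hD0)
  exact Prod.mk.injEq _ _ _ _ ▸ sub_eq_zero.1 ht0

/-- Existence of a solution of the boundary value problem inside any closed ball containing the
boundary data on which the nonlinearity has Lipschitz constant less than `c`. -/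
theorem exists_bvp_solution [CompleteSpace E] [CompleteSpace F]
    (hc : 0 < c) (hκ : 0 ≤ κ) (hκc : κ < c)
    (hA : ∀ v, ⟪A v, v⟫_ℝ ≤ -c * ‖v‖ ^ 2) (hB : ∀ v, c * ‖v‖ ^ 2 ≤ ⟪B v, v⟫_ℝ)
    (hfc : Continuous f) (hgc : Continuous g) (hf0 : f 0 = 0) (hg0 : g 0 = 0)
    (hf : ∀ p ∈ Metric.closedBall 0 R, ∀ q ∈ Metric.closedBall 0 R, ‖f p - f q‖ ≤ κ * ‖p - q‖)
    (hg : ∀ p ∈ Metric.closedBall 0 R, ∀ q ∈ Metric.closedBall 0 R, ‖g p - g q‖ ≤ κ * ‖p - q‖)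
    (hτ : 0 ≤ τ) {x₀ : E} {y₁ : F} (hx₀ : ‖x₀‖ ≤ R) (hy₁ : ‖y₁‖ ≤ R) :
    ∃ (x : ℝ → E) (y : ℝ → F),
      (∀ t ∈ Icc 0 τ, HasDerivWithinAt x (A (x t) + f (x t, y t)) (Icc 0 τ) t) ∧
      (∀ t ∈ Icc 0 τ, HasDerivWithinAt y (B (y t) + g (x t, y t)) (Icc 0 τ) t) ∧
      x 0 = x₀ ∧ y τ = y₁ ∧ ∀ t ∈ Icc 0 τ, (x t, y t) ∈ Metric.closedBall 0 R := by
  have hR0 : 0 ≤ R := (norm_nonneg _).trans hx₀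
  have h0mem : (0 : E × F) ∈ Metric.closedBall 0 R := Metric.mem_closedBall_self hR0
  have hproj : ∀ z : C(Icc 0 τ, E × F), Continuous fun t => z (projIcc 0 τ hτ t) :=
    fun z => z.continuous.comp continuous_projIcc
  choose X hX0 hX using fun z : C(Icc 0 τ, E × F) =>
    exists_hasDerivAt_linear A (hfc.comp (hproj z)) 0 x₀
  choose Y hY1 hY using fun z : C(Icc 0 τ, E × F) =>
    exists_hasDerivAt_linear B (hgc.comp (hproj z)) τ y₁
  have hXc : ∀ z, Continuous (X z) := fun z =>
    continuous_iff_continuousAt.2 fun t => (hX z t).continuousAt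
  have hYc : ∀ z, Continuous (Y z) := fun z =>
    continuous_iff_continuousAt.2 fun t => (hY z t).continuousAt
  let T : C(Icc 0 τ, E × F) → C(Icc 0 τ, E × F) := fun z =>
    ⟨fun t => (X z t, Y z t), by
      have := hXc z
      have := hYc z
      fun_prop⟩
  have hball : ∀ z ∈ Metric.closedBall (0 : C(Icc 0 τ, E × F)) R, ∀ t,
      z t ∈ Metric.closedBall (0 : E × F) R := fun z hz t =>
    mem_closedBall_zero_iff.2 ((z.norm_coe_le_norm t).trans (mem_closedBall_zero_iff.1 hz))
  have hmaps : MapsTo T (Metric.closedBall 0 R) (Metric.closedBall 0 R) := by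
    intro z hz
    refine mem_closedBall_zero_iff.2 ((ContinuousMap.norm_le _ hR0).2 fun t => max_le ?_ ?_)
    · refine norm_le_of_dissipative hc hA (fun s _ => (hX z s).hasDerivWithinAt) (fun s _ => ?_)
        (by rwa [hX0]) (mul_le_mul_of_nonneg_right hκc.le hR0) t t.2
      have hzs := hball z hz (projIcc 0 τ hτ s)
      have := hf _ hzs 0 h0mem
      rw [hf0, sub_zero, sub_zero] at this
      exact this.trans (mul_le_mul_of_nonneg_left (mem_closedBall_zero_iff.1 hzs) hκ)
    · refine norm_le_of_expanding hc hB (fun s _ => (hY z s).hasDerivWithinAt) (fun s _ => ?_)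
        (by rwa [hY1]) (mul_le_mul_of_nonneg_right hκc.le hR0) t t.2
      have hzs := hball z hz (projIcc 0 τ hτ s)
      have := hg _ hzs 0 h0mem
      rw [hg0, sub_zero, sub_zero] at this
      exact this.trans (mul_le_mul_of_nonneg_left (mem_closedBall_zero_iff.1 hzs) hκ)
  have hcontr : ContractingWith ⟨κ / c, by positivity⟩ (hmaps.restrict T _ _) := by
    refine ⟨(div_lt_one hc).2 hκc, LipschitzWith.of_dist_le_mul fun z w => ?_⟩
    have hD : 0 ≤ κ / c * dist z w := by positivity
    have hmul : c * (κ / c * dist z w) = κ * dist z w := by field_simp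
    refine (ContinuousMap.dist_le hD).2 fun t => ?_
    have hdist : ∀ s, ‖z.1 s - w.1 s‖ ≤ dist z w := fun s => by
      rw [← dist_eq_norm]
      exact ContinuousMap.dist_apply_le_dist s
    rw [dist_eq_norm]
    exact norm_sub_le_of_forcing hc hD hA hB (fun s _ => (hX z s).hasDerivWithinAt)
      (fun s _ => (hY z s).hasDerivWithinAt) (fun s _ => (hX w s).hasDerivWithinAt)
      (fun s _ => (hY w s).hasDerivWithinAt) (by rw [hX0, hX0]) (by rw [hY1, hY1])
      (fun s _ => hmul ▸ (hf _ (hball z z.2 _) _ (hball w w.2 _)).trans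
        (mul_le_mul_of_nonneg_left (hdist _) hκ))
      (fun s _ => hmul ▸ (hg _ (hball z z.2 _) _ (hball w w.2 _)).trans
        (mul_le_mul_of_nonneg_left (hdist _) hκ)) t t.2
  obtain ⟨z, hzR, hz, -⟩ := hcontr.exists_fixedPoint' Metric.isClosed_closedBall.isComplete hmaps
    (Metric.mem_closedBall_self hR0) (edist_ne_top _ _)
  have hzt : ∀ t (ht : t ∈ Icc 0 τ), z ⟨t, ht⟩ = (X z t, Y z t) := fun t ht =>
    (DFunLike.congr_fun hz ⟨t, ht⟩).symm
  refine ⟨X z, Y z, fun t ht => ?_, fun t ht => ?_, hX0 z, hY1 z, fun t ht => ?_⟩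
  · have := (hX z t).hasDerivWithinAt (s := Icc 0 τ)
    rwa [Function.comp_apply, projIcc_of_mem hτ ht, hzt t ht] at this
  · have := (hY z t).hasDerivWithinAt (s := Icc 0 τ)
    rwa [Function.comp_apply, projIcc_of_mem hτ ht, hzt t ht] at this
  · exact hzt t ht ▸ hball z hzR _

end BoundaryValueProblem

/-- A `C¹` map whose derivative has norm less than `c` on a closed ball is Lipschitz on that ball
with a constant less than `c`. -/
theorem exists_lipschitz_lt_of_fderiv_lt {V W : Type*} [NormedAddCommGroup V] [NormedSpace ℝ V]
    [ProperSpace V] [NormedAddCommGroup W] [NormedSpace ℝ W] {Φ : V → W} (hΦ : ContDiff ℝ 1 Φ)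
    {R c : ℝ} (hR : 0 ≤ R) (hlt : ∀ p ∈ Metric.closedBall (0 : V) R, ‖fderiv ℝ Φ p‖ < c) :
    ∃ κ, 0 ≤ κ ∧ κ < c ∧ ∀ p ∈ Metric.closedBall (0 : V) R, ∀ q ∈ Metric.closedBall (0 : V) R,
      ‖Φ p - Φ q‖ ≤ κ * ‖p - q‖ := by
  obtain ⟨p₀, hp₀, hmax⟩ := (isCompact_closedBall (0 : V) R).exists_isMaxOn
    ⟨0, Metric.mem_closedBall_self hR⟩ (hΦ.continuous_fderiv one_ne_zero).norm.continuousOn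
  exact ⟨_, norm_nonneg _, hlt p₀ hp₀, fun p hp q hq =>
    (convex_closedBall 0 R).norm_image_sub_le_of_norm_fderiv_le
      (fun v _ => (hΦ.differentiable one_ne_zero) v) (fun v hv => hmax hv) hq hp⟩

/-- **Boundary value well-posedness (Shilnikov).** -/
theorem stmt_0 {s u : ℕ} (hs : 1 ≤ s) (hu : 1 ≤ u)
    (Lm : Matrix (Fin s) (Fin s) ℝ) (Lp : Matrix (Fin u) (Fin u) ℝ)
    (hLmsymm : Lm.IsSymm) (hLpsymm : Lp.IsSymm)
    (lam mu : ℝ) (hlam : 0 < lam) (hmu : 0 < mu)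
    (hLm : ∀ x : EuclideanSpace ℝ (Fin s), ⟪matCLM Lm x, x⟫_ℝ ≤ -lam * ‖x‖ ^ 2)
    (hLp : ∀ y : EuclideanSpace ℝ (Fin u), mu * ‖y‖ ^ 2 ≤ ⟪matCLM Lp y, y⟫_ℝ)
    (f : EuclideanSpace ℝ (Fin s) × EuclideanSpace ℝ (Fin u) → EuclideanSpace ℝ (Fin s))
    (g : EuclideanSpace ℝ (Fin s) × EuclideanSpace ℝ (Fin u) → EuclideanSpace ℝ (Fin u))
    (hF : ContDiff ℝ 1 fun p => (f p, g p))
    (hF0 : f 0 = 0 ∧ g 0 = 0)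
    (hDF0 : fderiv ℝ (fun p => (f p, g p)) 0 = 0)
    (ε : ℝ) (hε : 0 < ε)
    (hsmall : ∀ p : EuclideanSpace ℝ (Fin s) × EuclideanSpace ℝ (Fin u),
      max ‖p.1‖ ‖p.2‖ ≤ 2 * ε →
        ‖(f p, g p)‖ + ‖fderiv ℝ (fun q => (f q, g q)) p‖ < min lam mu) :
    ∀ τ : ℝ, 0 ≤ τ →
    ∀ (x₀ : EuclideanSpace ℝ (Fin s)) (y₁ : EuclideanSpace ℝ (Fin u)),
      max ‖x₀‖ ‖y₁‖ < ε →
      ∃ (x : ℝ → EuclideanSpace ℝ (Fin s)) (y : ℝ → EuclideanSpace ℝ (Fin u)),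
        (∀ t ∈ Icc (0 : ℝ) τ,
          HasDerivWithinAt x (matCLM Lm (x t) + f (x t, y t)) (Icc 0 τ) t) ∧
        (∀ t ∈ Icc (0 : ℝ) τ,
          HasDerivWithinAt y (matCLM Lp (y t) + g (x t, y t)) (Icc 0 τ) t) ∧
        x 0 = x₀ ∧ y τ = y₁ ∧
        (∀ t ∈ Icc (0 : ℝ) τ, max ‖x t‖ ‖y t‖ ≤ 2 * max ‖x₀‖ ‖y₁‖) ∧
        (∀ (x' : ℝ → EuclideanSpace ℝ (Fin s)) (y' : ℝ → EuclideanSpace ℝ (Fin u)),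
          (∀ t ∈ Icc (0 : ℝ) τ,
            HasDerivWithinAt x' (matCLM Lm (x' t) + f (x' t, y' t)) (Icc 0 τ) t) →
          (∀ t ∈ Icc (0 : ℝ) τ,
            HasDerivWithinAt y' (matCLM Lp (y' t) + g (x' t, y' t)) (Icc 0 τ) t) →
          x' 0 = x₀ → y' τ = y₁ →
          (∀ t ∈ Icc (0 : ℝ) τ, max ‖x' t‖ ‖y' t‖ ≤ 2 * ε) →
          ∀ t ∈ Icc (0 : ℝ) τ, x' t = x t ∧ y' t = y t) := by
  intro τ hτ x₀ y₁ hN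
  have hc : 0 < min lam mu := lt_min hlam hmu
  have hA : ∀ v, ⟪matCLM Lm v, v⟫_ℝ ≤ -min lam mu * ‖v‖ ^ 2 := fun v =>
    (hLm v).trans (by gcongr; exact min_le_left _ _)
  have hB : ∀ v, min lam mu * ‖v‖ ^ 2 ≤ ⟪matCLM Lp v, v⟫_ℝ := fun v =>
    le_trans (by gcongr; exact min_le_right _ _) (hLp v)
  obtain ⟨κ, hκ, hκc, hlip⟩ := exists_lipschitz_lt_of_fderiv_lt hF (R := 2 * ε) (by positivity)
    fun p hp => (le_add_of_nonneg_left (norm_nonneg _)).trans_lt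
      (hsmall p (mem_closedBall_zero_iff.1 hp))
  have hf : ∀ p ∈ Metric.closedBall 0 (2 * ε), ∀ q ∈ Metric.closedBall 0 (2 * ε),
      ‖f p - f q‖ ≤ κ * ‖p - q‖ := fun p hp q hq => (le_max_left _ _).trans (hlip p hp q hq)
  have hg : ∀ p ∈ Metric.closedBall 0 (2 * ε), ∀ q ∈ Metric.closedBall 0 (2 * ε),
      ‖g p - g q‖ ≤ κ * ‖p - q‖ := fun p hp q hq => (le_max_right _ _).trans (hlip p hp q hq)
  have hN0 : 0 ≤ max ‖x₀‖ ‖y₁‖ := (norm_nonneg _).trans (le_max_left _ _)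
  have hsub : Metric.closedBall (0 : EuclideanSpace ℝ (Fin s) × EuclideanSpace ℝ (Fin u))
      (max ‖x₀‖ ‖y₁‖) ⊆ Metric.closedBall 0 (2 * ε) :=
    Metric.closedBall_subset_closedBall (by linarith)
  obtain ⟨x, y, hx, hy, hx0, hy1, hbd⟩ := exists_bvp_solution hc hκ hκc hA hB
    hF.continuous.fst hF.continuous.snd hF0.1 hF0.2
    (fun p hp q hq => hf p (hsub hp) q (hsub hq)) (fun p hp q hq => hg p (hsub hp) q (hsub hq))
    hτ (le_max_left ‖x₀‖ ‖y₁‖) (le_max_right ‖x₀‖ ‖y₁‖)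
  refine ⟨x, y, hx, hy, hx0, hy1, fun t ht => ?_, fun x' y' hx' hy' hx0' hy1' hbd' => ?_⟩
  · exact (mem_closedBall_zero_iff.1 (hbd t ht)).trans (by linarith)
  · exact bvp_unique hc hκ hκc hA hB hf hg hx' hy' hx hy (hx0'.trans hx0.symm)
      (hy1'.trans hy1.symm) (fun t ht => mem_closedBall_zero_iff.2 (hbd' t ht))
      (fun t ht => hsub (hbd t ht))
end

section
/- Gronwall estimates for BVP solutions in straightened coordinates: Assume hypothesis H(α,δ,ε) with 0 ≤ δ < α. Let (x, y) : [0,τ] → ℝ^s × ℝ^u be a C¹ solution of the straightened system taking values in C_{2ε}, with max(‖x(0)‖, ‖y(τ)‖) ≤ ε. Then for every t ∈ [0,τ]: ‖x(t)‖ ≤ ‖x(0)‖·e^{-(α-δ)t} and ‖y(t)‖ ≤ ‖y(τ)‖·e^{(α-δ)(t-τ)}. In particular ‖x(τ)‖ ≤ ‖x(0)‖·e^{-(α-δ)τ} and ‖y(0)‖ ≤ ‖y(τ)‖·e^{-(α-δ)τ}. -/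
open Set
open scoped InnerProductSpace

section Gronwall

variable {E : Type*} [NormedAddCommGroup E] [InnerProductSpace ℝ E]

theorem HasDerivWithinAt.exp_mul_norm_sq {z : ℝ → E} {z' : E} {S : Set ℝ} {t : ℝ} (c : ℝ)
    (hz : HasDerivWithinAt z z' S t) :
    HasDerivWithinAt (fun r => Real.exp (-(2 * c) * r) * ‖z r‖ ^ 2)
      (2 * Real.exp (-(2 * c) * t) * (⟪z', z t⟫_ℝ - c * ‖z t‖ ^ 2)) S t := by
  have h1 : HasDerivWithinAt (fun r : ℝ => Real.exp (-(2 * c) * r))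
      (Real.exp (-(2 * c) * t) * (-(2 * c) * 1)) S t :=
    ((hasDerivWithinAt_id t S).const_mul (-(2 * c))).exp
  refine (h1.mul hz.norm_sq).congr_deriv ?_
  rw [real_inner_comm]
  ring

theorem norm_le_of_exp_mul_norm_sq_le {F : Type*} [SeminormedAddCommGroup F]
    {a b : F} {c r t : ℝ}
    (h : Real.exp (-(2 * c) * t) * ‖b‖ ^ 2 ≤ Real.exp (-(2 * c) * r) * ‖a‖ ^ 2) :
    ‖b‖ ≤ ‖a‖ * Real.exp (c * (t - r)) := by
  refine le_of_sq_le_sq ?_ (by positivity)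
  calc ‖b‖ ^ 2 = Real.exp (2 * c * t) * (Real.exp (-(2 * c) * t) * ‖b‖ ^ 2) := by
        rw [← mul_assoc, ← Real.exp_add]; simp
    _ ≤ Real.exp (2 * c * t) * (Real.exp (-(2 * c) * r) * ‖a‖ ^ 2) := by gcongr
    _ = (‖a‖ * Real.exp (c * (t - r))) ^ 2 := by
        rw [← mul_assoc, ← Real.exp_add, mul_pow, ← Real.exp_nat_mul, mul_comm]
        congr 2
        push_cast
        ring

/-- Forward Gronwall estimate for a curve whose velocity satisfies `⟪z', z⟫ ≤ c ‖z‖²`. -/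
theorem norm_le_mul_exp_of_inner_deriv_le {z z' : ℝ → E} {a b c : ℝ}
    (hz : ∀ t ∈ Icc a b, HasDerivWithinAt z (z' t) (Icc a b) t)
    (h : ∀ t ∈ Icc a b, ⟪z' t, z t⟫_ℝ ≤ c * ‖z t‖ ^ 2) {t : ℝ} (ht : t ∈ Icc a b) :
    ‖z t‖ ≤ ‖z a‖ * Real.exp (c * (t - a)) := by
  have key := fun r hr => (hz r hr).exp_mul_norm_sq c
  have hanti : AntitoneOn (fun r => Real.exp (-(2 * c) * r) * ‖z r‖ ^ 2) (Icc a b) :=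
    antitoneOn_of_hasDerivWithinAt_nonpos (convex_Icc a b)
      (fun r hr => (key r hr).continuousWithinAt)
      (fun r hr => (key r (interior_subset hr)).mono interior_subset)
      fun r hr => mul_nonpos_of_nonneg_of_nonpos (by positivity)
        (sub_nonpos.2 (h r (interior_subset hr)))
  exact norm_le_of_exp_mul_norm_sq_le (hanti ⟨le_rfl, ht.1.trans ht.2⟩ ht ht.1)

/-- Backward Gronwall estimate for a curve whose velocity satisfies `c ‖z‖² ≤ ⟪z', z⟫`. -/
theorem norm_le_mul_exp_of_le_inner_deriv {z z' : ℝ → E} {a b c : ℝ}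
    (hz : ∀ t ∈ Icc a b, HasDerivWithinAt z (z' t) (Icc a b) t)
    (h : ∀ t ∈ Icc a b, c * ‖z t‖ ^ 2 ≤ ⟪z' t, z t⟫_ℝ) {t : ℝ} (ht : t ∈ Icc a b) :
    ‖z t‖ ≤ ‖z b‖ * Real.exp (c * (t - b)) := by
  have key := fun r hr => (hz r hr).exp_mul_norm_sq c
  have hmono : MonotoneOn (fun r => Real.exp (-(2 * c) * r) * ‖z r‖ ^ 2) (Icc a b) :=
    monotoneOn_of_hasDerivWithinAt_nonneg (convex_Icc a b)
      (fun r hr => (key r hr).continuousWithinAt)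
      (fun r hr => (key r (interior_subset hr)).mono interior_subset)
      fun r hr => mul_nonneg (by positivity) (sub_nonneg.2 (h r (interior_subset hr)))
  exact norm_le_of_exp_mul_norm_sq_le (hmono ht ⟨ht.1.trans ht.2, le_rfl⟩ ht.2)

theorem abs_inner_apply_self_le {A : E →L[ℝ] E} {δ : ℝ} (hA : ‖A‖ ≤ δ) (v : E) :
    |⟪A v, v⟫_ℝ| ≤ δ * ‖v‖ ^ 2 :=
  calc |⟪A v, v⟫_ℝ| ≤ ‖A v‖ * ‖v‖ := abs_real_inner_le_norm _ _
    _ ≤ δ * ‖v‖ * ‖v‖ := by gcongr; exact A.le_of_opNorm_le hA v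
    _ = δ * ‖v‖ ^ 2 := by ring

end Gronwall

/-- **Gronwall estimates for BVP solutions in straightened coordinates.** -/
theorem stmt_1 {s u : ℕ} (hs : 1 ≤ s) (hu : 1 ≤ u)
    (Lm : Matrix (Fin s) (Fin s) ℝ) (Lp : Matrix (Fin u) (Fin u) ℝ)
    (hLmsymm : Lm.IsSymm) (hLpsymm : Lp.IsSymm)
    (ft : EuclideanSpace ℝ (Fin s) × EuclideanSpace ℝ (Fin u) → Matrix (Fin s) (Fin s) ℝ)
    (gt : EuclideanSpace ℝ (Fin s) × EuclideanSpace ℝ (Fin u) → Matrix (Fin u) (Fin u) ℝ)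
    (hft : ContDiff ℝ 1 fun p => matCLM (ft p))
    (hgt : ContDiff ℝ 1 fun p => matCLM (gt p))
    (α δ ε : ℝ) (hδ : 0 ≤ δ) (hδα : δ < α) (hε : 0 < ε)
    (hLm : ∀ x : EuclideanSpace ℝ (Fin s), ⟪matCLM Lm x, x⟫_ℝ ≤ -α * ‖x‖ ^ 2)
    (hLp : ∀ y : EuclideanSpace ℝ (Fin u), α * ‖y‖ ^ 2 ≤ ⟪matCLM Lp y, y⟫_ℝ)
    (hftδ : ∀ x y, max ‖x‖ ‖y‖ ≤ 2 * ε → ‖matCLM (ft (x, y))‖ ≤ δ)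
    (hgtδ : ∀ x y, max ‖x‖ ‖y‖ ≤ 2 * ε → ‖matCLM (gt (x, y))‖ ≤ δ)
    (τ : ℝ) (hτ : 0 ≤ τ)
    (x : ℝ → EuclideanSpace ℝ (Fin s)) (y : ℝ → EuclideanSpace ℝ (Fin u))
    (hx : ∀ t ∈ Icc (0 : ℝ) τ,
      HasDerivWithinAt x (matCLM Lm (x t) + matCLM (ft (x t, y t)) (x t)) (Icc 0 τ) t)
    (hy : ∀ t ∈ Icc (0 : ℝ) τ,
      HasDerivWithinAt y (matCLM Lp (y t) + matCLM (gt (x t, y t)) (y t)) (Icc 0 τ) t)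
    (hvals : ∀ t ∈ Icc (0 : ℝ) τ, max ‖x t‖ ‖y t‖ ≤ 2 * ε)
    (hinit : max ‖x 0‖ ‖y τ‖ ≤ ε) :
    (∀ t ∈ Icc (0 : ℝ) τ,
      ‖x t‖ ≤ ‖x 0‖ * Real.exp (-(α - δ) * t) ∧
      ‖y t‖ ≤ ‖y τ‖ * Real.exp ((α - δ) * (t - τ))) ∧
    ‖x τ‖ ≤ ‖x 0‖ * Real.exp (-(α - δ) * τ) ∧
    ‖y 0‖ ≤ ‖y τ‖ * Real.exp (-(α - δ) * τ) := by
  have hX : ∀ t ∈ Icc (0 : ℝ) τ, ‖x t‖ ≤ ‖x 0‖ * Real.exp (-(α - δ) * t) := fun t ht => by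
    simpa using norm_le_mul_exp_of_inner_deriv_le (c := -(α - δ)) hx (fun r hr => by
      have h := abs_le.1 (abs_inner_apply_self_le (hftδ _ _ (hvals r hr)) (x r))
      rw [inner_add_left]
      linarith [hLm (x r), h.2]) ht
  have hY : ∀ t ∈ Icc (0 : ℝ) τ, ‖y t‖ ≤ ‖y τ‖ * Real.exp ((α - δ) * (t - τ)) := fun t ht =>
    norm_le_mul_exp_of_le_inner_deriv hy (fun r hr => by
      have h := abs_le.1 (abs_inner_apply_self_le (hgtδ _ _ (hvals r hr)) (y r))
      rw [inner_add_left]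
      linarith [hLp (y r), h.1]) ht
  refine ⟨fun t ht => ⟨hX t ht, hY t ht⟩, hX τ ⟨hτ, le_rfl⟩, ?_⟩
  simpa only [zero_sub, mul_neg, neg_mul] using hY 0 ⟨le_rfl, hτ⟩
end

section
/- Straightening coordinates: Let X(p) = Lp + F(p) be a vector field on ℝ^s × ℝ^u, where L = L⁻ ⊕ L⁺ is block diagonal with L⁻ real symmetric negative definite of size s and L⁺ real symmetric positive definite of size u, and F is C^∞ with F(0) = 0 and DF(0) = 0. Then there exist open neighborhoods Ω, Ω' of the origin in ℝ^s × ℝ^u and a C^∞ diffeomorphism φ : Ω → Ω' with φ(0) = 0, together with C^∞ maps f̃ : Ω' → Matrix (Fin s) (Fin s) ℝ and g̃ : Ω' → Matrix (Fin u) (Fin u) ℝ vanishing at the origin, such that the pushforward vector field Y(q) := Dφ(φ⁻¹(q))·X(φ⁻¹(q)) satisfies Y(x,y) = (L⁻x + f̃(x,y)x, L⁺y + g̃(x,y)y) for all (x,y) ∈ Ω'. (In particular, in the new coordinates the subspaces {y = 0} and {x = 0} are locally invariant under the flow of Y.) -/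
open Set
open scoped InnerProductSpace

section Straightening

open Filter MeasureTheory
open scoped BoundedContinuousFunction NNReal Topology

universe v

section Superposition

variable {α : Type*} [TopologicalSpace α]

/-- The superposition (Nemytskii) operator `z ↦ F ∘ z` on bounded continuous functions with values
in a proper space. -/
noncomputable def superpos {E G : Type*} [NormedAddCommGroup E] [ProperSpace E]
    [NormedAddCommGroup G] (F : E → G) (hF : Continuous F) (z : α →ᵇ E) : α →ᵇ G :=
  BoundedContinuousFunction.mkOfBound ⟨F ∘ z, hF.comp z.continuous⟩
    (Metric.isBounded_iff.1
      ((isCompact_closedBall (0 : E) ‖z‖).image hF).isBounded).choose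
    (fun x y => (Metric.isBounded_iff.1
      ((isCompact_closedBall (0 : E) ‖z‖).image hF).isBounded).choose_spec
        ⟨z x, by simpa using z.norm_coe_le_norm x, rfl⟩
        ⟨z y, by simpa using z.norm_coe_le_norm y, rfl⟩)

@[simp] lemma superpos_apply {E G : Type*} [NormedAddCommGroup E] [ProperSpace E]
    [NormedAddCommGroup G] (F : E → G) (hF : Continuous F) (z : α →ᵇ E) (t : α) :
    superpos F hF z t = F (z t) := rfl

lemma continuous_superpos {E G : Type*} [NormedAddCommGroup E] [ProperSpace E]
    [NormedAddCommGroup G] (F : E → G) (hF : Continuous F) :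
    Continuous (superpos F hF : (α →ᵇ E) → α →ᵇ G) := by
  rw [Metric.continuous_iff]
  intro z ε hε
  have huc := (isCompact_closedBall (0 : E) (‖z‖ + 1)).uniformContinuousOn_of_continuous
    hF.continuousOn
  obtain ⟨δ, hδ, h⟩ := Metric.uniformContinuousOn_iff.1 huc (ε / 2) (half_pos hε)
  refine ⟨min δ 1, lt_min hδ one_pos, fun v hv => ?_⟩
  refine lt_of_le_of_lt ((BoundedContinuousFunction.dist_le (half_pos hε).le).2 fun t => ?_)
    (half_lt_self hε)
  have hvz : dist (v t) (z t) < min δ 1 :=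
    (BoundedContinuousFunction.dist_coe_le_dist t).trans_lt hv
  refine (h _ ?_ _ ?_ (hvz.trans_le (min_le_left _ _))).le
  · have h1 := z.norm_coe_le_norm t
    have h2 := hvz.trans_le (min_le_right _ _)
    rw [dist_eq_norm] at h2
    have h3 := norm_le_norm_add_norm_sub' (v t) (z t)
    simp only [mem_closedBall_zero_iff]
    linarith
  · have h1 := z.norm_coe_le_norm t
    simp only [mem_closedBall_zero_iff]
    linarith

variable {E G : Type*} [NormedAddCommGroup E] [NormedSpace ℝ E]
  [NormedAddCommGroup G] [NormedSpace ℝ G]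

/-- Pointwise application of an operator-valued bounded continuous function. -/
noncomputable def pointwiseApply : (α →ᵇ (E →L[ℝ] G)) →L[ℝ] (α →ᵇ E) →L[ℝ] (α →ᵇ G) :=
  LinearMap.mkContinuous₂
    (LinearMap.mk₂ ℝ (fun (M : α →ᵇ (E →L[ℝ] G)) (v : α →ᵇ E) =>
      BoundedContinuousFunction.ofNormedAddCommGroup (fun t => M t (v t))
        (M.continuous.clm_apply v.continuous) (‖M‖ * ‖v‖)
        (fun t => (M t).le_of_opNorm_le_of_le (M.norm_coe_le_norm t) (v.norm_coe_le_norm t)))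
      (fun _ _ _ => by ext; simp) (fun _ _ _ => by ext; simp)
      (fun _ _ _ => by ext; simp) (fun _ _ _ => by ext; simp)) 1
    (fun M v => by
      rw [one_mul]
      exact (BoundedContinuousFunction.norm_le (by positivity)).2 fun t =>
        (M t).le_of_opNorm_le_of_le (M.norm_coe_le_norm t) (v.norm_coe_le_norm t))

@[simp] lemma pointwiseApply_apply (M : α →ᵇ (E →L[ℝ] G)) (v : α →ᵇ E) (t : α) :
    pointwiseApply M v t = M t (v t) := rfl

lemma hasFDerivAt_superpos [FiniteDimensional ℝ E] (F : E → G) (hF : ContDiff ℝ 1 F)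
    (z : α →ᵇ E) :
    HasFDerivAt (superpos F hF.continuous : (α →ᵇ E) → α →ᵇ G)
      (pointwiseApply (superpos (fderiv ℝ F) (hF.continuous_fderiv one_ne_zero) z)) z := by
  rw [hasFDerivAt_iff_isLittleO_nhds_zero, Asymptotics.isLittleO_iff]
  intro ε hε
  obtain ⟨δ, hδ, h⟩ := Metric.continuous_iff.1
    (continuous_superpos (α := α) (fderiv ℝ F) (hF.continuous_fderiv one_ne_zero)) z ε hε
  filter_upwards [Metric.ball_mem_nhds (0 : α →ᵇ E) hδ] with v hv
  refine (BoundedContinuousFunction.norm_le (by positivity)).2 fun t => ?_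
  have hvn : ‖v‖ < δ := by simpa using hv
  have hbound : ∀ w ∈ Metric.ball (z t) δ, ‖fderiv ℝ F w - fderiv ℝ F (z t)‖ ≤ ε := by
    intro w hw
    have h1 : dist (z + BoundedContinuousFunction.const α (w - z t)) z < δ := by
      rw [dist_eq_norm, add_sub_cancel_left]
      refine lt_of_le_of_lt (BoundedContinuousFunction.norm_const_le _) ?_
      rwa [← dist_eq_norm]
    have h2 := (BoundedContinuousFunction.dist_coe_le_dist t).trans (h _ h1).le
    simpa [dist_eq_norm] using h2
  have hvt : ‖v t‖ ≤ ‖v‖ := v.norm_coe_le_norm t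
  have := (convex_ball (z t) δ).norm_image_sub_le_of_norm_hasFDerivWithin_le' (f := F)
    (fun w _ => ((hF.differentiable one_ne_zero) w).hasFDerivAt.hasFDerivWithinAt) hbound
    (Metric.mem_ball_self hδ) (y := z t + v t) (by simpa using hvt.trans_lt hvn)
  simp only [add_sub_cancel_left] at this
  simpa using this.trans (mul_le_mul_of_nonneg_left hvt hε.le)

end Superposition

lemma contDiff_superpos {α : Type*} [TopologicalSpace α] {E G : Type v}
    [NormedAddCommGroup E] [NormedSpace ℝ E] [FiniteDimensional ℝ E] [ProperSpace E]
    [NormedAddCommGroup G] [NormedSpace ℝ G]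
    (F : E → G) (hF : ContDiff ℝ (⊤ : ℕ∞) F) :
    ContDiff ℝ (⊤ : ℕ∞) (superpos F hF.continuous : (α →ᵇ E) → α →ᵇ G) := by
  rw [contDiff_infty]
  intro n
  induction n generalizing G with
  | zero => exact contDiff_zero.2 (continuous_superpos F hF.continuous)
  | succ n ih =>
    have hF1 : ContDiff ℝ 1 F := hF.of_le (by exact_mod_cast le_top)
    refine contDiff_succ_iff_hasFDerivAt.2 ⟨_, ?_, fun z => hasFDerivAt_superpos F hF1 z⟩
    exact pointwiseApply.contDiff.comp (ih (fderiv ℝ F) (hF.fderiv_right (by norm_cast)))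
lemma ContDiff.intervalIntegral_unit {X W : Type*} [NormedAddCommGroup X] [NormedSpace ℝ X]
    [NormedAddCommGroup W] [NormedSpace ℝ W] {n : WithTop ℕ∞} {f : X → ℝ →ᵇ W}
    (hf : ContDiff ℝ n f) : ContDiff ℝ n fun x => ∫ θ in (0 : ℝ)..1, f x θ := by
  let int : (ℝ →ᵇ W) →L[ℝ] W := LinearMap.mkContinuous
    { toFun := fun f : ℝ →ᵇ W => ∫ θ in (0 : ℝ)..1, f θ
      map_add' := fun (f g : ℝ →ᵇ W) => intervalIntegral.integral_add
        (f.continuous.intervalIntegrable _ _) (g.continuous.intervalIntegrable _ _)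
      map_smul' := fun r f => intervalIntegral.integral_smul r f } 1
    (fun f => by
      simpa [mul_comm] using intervalIntegral.norm_integral_le_of_norm_le_const (a := (0 : ℝ))
        (b := 1) (fun θ _ => f.norm_coe_le_norm θ))
  exact int.contDiff.comp hf

/-- Hadamard's lemma: the increment of a smooth map is given by a smooth operator-valued map. -/
lemma exists_contDiff_hadamard {E G : Type v}
    [NormedAddCommGroup E] [NormedSpace ℝ E] [FiniteDimensional ℝ E] [ProperSpace E]
    [NormedAddCommGroup G] [NormedSpace ℝ G] [CompleteSpace G]
    (F : E → G) (hF : ContDiff ℝ (⊤ : ℕ∞) F) :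
    ∃ M : E × E → (E →L[ℝ] G), ContDiff ℝ (⊤ : ℕ∞) M ∧
      (∀ p q, F q - F p = M (p, q) (q - p)) ∧ ∀ p, M (p, p) = fderiv ℝ F p := by
  have hF' : ContDiff ℝ (⊤ : ℕ∞) (fderiv ℝ F) := hF.fderiv_right (by norm_cast)
  let c : ℝ → ℝ := fun θ => projIcc (0 : ℝ) 1 zero_le_one θ
  have hc : Continuous c := continuous_subtype_val.comp continuous_projIcc
  have hc0 : ∀ θ, 0 ≤ c θ := fun θ => (projIcc (0 : ℝ) 1 zero_le_one θ).2.1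
  have hc1 : ∀ θ, c θ ≤ 1 := fun θ => (projIcc (0 : ℝ) 1 zero_le_one θ).2.2
  have hcθ : ∀ θ ∈ Icc (0 : ℝ) 1, c θ = θ := fun θ h => by simp only [c, projIcc_of_mem _ h]
  have hb : ∀ (p : E × E) θ, ‖p.1 + c θ • (p.2 - p.1)‖ ≤ 3 * ‖p‖ := fun p θ => by
    have h1 := norm_fst_le p
    have h2 := norm_snd_le p
    have h3 : ‖c θ • (p.2 - p.1)‖ ≤ 1 * ‖p.2 - p.1‖ := by
      rw [norm_smul, Real.norm_of_nonneg (hc0 θ)]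
      exact mul_le_mul_of_nonneg_right (hc1 θ) (norm_nonneg _)
    linarith [norm_add_le p.1 (c θ • (p.2 - p.1)), norm_sub_le p.2 p.1]
  let seg : (E × E) →L[ℝ] (ℝ →ᵇ E) := LinearMap.mkContinuous
    { toFun := fun p => BoundedContinuousFunction.ofNormedAddCommGroup
        (fun θ => p.1 + c θ • (p.2 - p.1)) (by fun_prop) (3 * ‖p‖) (hb p)
      map_add' := fun p q => by
        ext θ
        simp only [BoundedContinuousFunction.coe_ofNormedAddCommGroup,
          BoundedContinuousFunction.coe_add, Pi.add_apply, Prod.fst_add, Prod.snd_add]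
        module
      map_smul' := fun r p => by
        ext θ
        simp only [BoundedContinuousFunction.coe_ofNormedAddCommGroup,
          BoundedContinuousFunction.coe_smul, Prod.smul_fst, Prod.smul_snd, RingHom.id_apply]
        module } 3
    (fun p => (BoundedContinuousFunction.norm_le (by positivity)).2 (hb p))
  have hsuper : ∀ p : E × E, ∫ θ in (0 : ℝ)..1, superpos (fderiv ℝ F) hF'.continuous (seg p) θ =
      ∫ θ in (0 : ℝ)..1, fderiv ℝ F (p.1 + θ • (p.2 - p.1)) := fun p => by
    refine intervalIntegral.integral_congr fun θ hθ => ?_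
    rw [uIcc_of_le zero_le_one] at hθ
    rw [superpos_apply]
    change fderiv ℝ F (p.1 + c θ • (p.2 - p.1)) = _
    rw [hcθ θ hθ]
  refine ⟨fun p => ∫ θ in (0 : ℝ)..1, superpos (fderiv ℝ F) hF'.continuous (seg p) θ,
    ((contDiff_superpos (fderiv ℝ F) hF').comp seg.contDiff).intervalIntegral_unit,
    fun p q => ?_, fun p => ?_⟩
  · have hcont : Continuous fun θ : ℝ => fderiv ℝ F (p + θ • (q - p)) :=
      hF'.continuous.comp (by fun_prop)
    have hder : ∀ θ : ℝ, HasDerivAt (fun θ : ℝ => F (p + θ • (q - p)))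
        (fderiv ℝ F (p + θ • (q - p)) (q - p)) θ := fun θ => by
      have h1 : HasDerivAt (fun θ : ℝ => p + θ • (q - p)) (q - p) θ := by
        simpa using ((hasDerivAt_id θ).smul_const (q - p)).const_add p
      exact ((hF.differentiable (by simp)) _).hasFDerivAt.comp_hasDerivAt θ h1
    have h := intervalIntegral.integral_eq_sub_of_hasDerivAt (a := 0) (b := 1)
      (fun θ _ => hder θ) ((hcont.clm_apply continuous_const).intervalIntegrable _ _)
    simp only [hsuper]
    rw [ContinuousLinearMap.intervalIntegral_apply (hcont.intervalIntegrable _ _), h]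
    simp
  · simp only [hsuper]
    simp

/-- Smooth inverse function theorem at the origin, with tangent map the identity. -/
lemma exists_smooth_local_inverse {E : Type*} [NormedAddCommGroup E] [NormedSpace ℝ E]
    [CompleteSpace E] {Φ : E → E} {U : Set E} (hU : IsOpen U) (h0U : (0 : E) ∈ U)
    (hΦ : ContDiffOn ℝ (⊤ : ℕ∞) Φ U) (hΦ0 : Φ 0 = 0)
    (hΦ' : HasFDerivAt Φ (ContinuousLinearMap.id ℝ E) 0) :
    ∃ e : OpenPartialHomeomorph E E, (e : E → E) = Φ ∧ (0 : E) ∈ e.source ∧ e.source ⊆ U ∧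
      ContDiffOn ℝ (⊤ : ℕ∞) e.symm e.target ∧
      HasFDerivAt e.symm (ContinuousLinearMap.id ℝ E) 0 := by
  have hat : ∀ z ∈ U, ContDiffAt ℝ (⊤ : ℕ∞) Φ z := fun z hz => hΦ.contDiffAt (hU.mem_nhds hz)
  have hΦ'' : HasFDerivAt Φ ((ContinuousLinearEquiv.refl ℝ E : E ≃L[ℝ] E) : E →L[ℝ] E) 0 := hΦ'
  let e₀ := (hat 0 h0U).toOpenPartialHomeomorph Φ hΦ'' (by simp)
  have he₀ : (e₀ : E → E) = Φ := rfl
  have h0 : (0 : E) ∈ e₀.source := (hat 0 h0U).mem_toOpenPartialHomeomorph_source hΦ'' (by simp)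
  let W : Set E := U ∩ fderiv ℝ Φ ⁻¹' range ((↑) : (E ≃L[ℝ] E) → E →L[ℝ] E)
  have hW : IsOpen W := (hΦ.continuousOn_fderiv_of_isOpen hU (by simp)).isOpen_inter_preimage hU
    ContinuousLinearEquiv.isOpen
  have h0W : (0 : E) ∈ W := ⟨h0U, ContinuousLinearEquiv.refl ℝ E, hΦ''.fderiv.symm⟩
  let e := e₀.restrOpen W hW
  have hes : e.source = e₀.source ∩ W := e₀.restrOpen_source W hW
  have h0e : (0 : E) ∈ e.source := hes ▸ ⟨h0, h0W⟩
  have hsymm : e.symm 0 = 0 := by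
    have := e.left_inv h0e
    rwa [show e 0 = 0 from hΦ0] at this
  have h0t : (0 : E) ∈ e.target := by
    have := e.map_source h0e
    rwa [show e 0 = 0 from hΦ0] at this
  refine ⟨e, rfl, h0e, fun z hz => (hes ▸ hz : z ∈ e₀.source ∩ W).2.1, fun y hy => ?_, ?_⟩
  · have hz := e.map_target hy
    rw [hes] at hz
    obtain ⟨T, hT⟩ := hz.2.2
    have hd : HasFDerivAt e (T : E →L[ℝ] E) (e.symm y) := by
      rw [hT]
      exact ((hat _ hz.2.1).differentiableAt (by simp)).hasFDerivAt
    exact (e.contDiffAt_symm hy hd (hat _ hz.2.1)).contDiffWithinAt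
  · exact e.hasFDerivAt_symm (f' := ContinuousLinearEquiv.refl ℝ E) h0t (by rw [hsymm]; exact hΦ'')
section LinearFlow

variable {V : Type*} [NormedAddCommGroup V] [InnerProductSpace ℝ V]

lemma exists_inner_le_neg_mul_sq [FiniteDimensional ℝ V] (A : V →L[ℝ] V)
    (hA : ∀ x, x ≠ 0 → ⟪A x, x⟫_ℝ < 0) :
    ∃ c > 0, ∀ x, ⟪A x, x⟫_ℝ ≤ -c * ‖x‖ ^ 2 := by
  rcases subsingleton_or_nontrivial V with hV | hV
  · exact ⟨1, one_pos, fun x => by simp [Subsingleton.elim x 0]⟩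
  obtain ⟨x₀, hx₀, hmax⟩ := (isCompact_sphere (0 : V) 1).exists_isMaxOn
    (NormedSpace.sphere_nonempty.2 zero_le_one)
    (f := fun x => ⟪A x, x⟫_ℝ) (by fun_prop)
  have hx₀0 : x₀ ≠ 0 := by
    rintro rfl
    simp at hx₀
  refine ⟨-⟪A x₀, x₀⟫_ℝ, neg_pos.2 (hA x₀ hx₀0), fun x => ?_⟩
  rcases eq_or_ne x 0 with rfl | hx
  · simp
  have hn : 0 < ‖x‖ := norm_pos_iff.2 hx
  have h := hmax (show ‖x‖⁻¹ • x ∈ Metric.sphere (0 : V) 1 by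
    simp [norm_smul, hn.ne'])
  simp only [mem_ofPred_eq, map_smul, real_inner_smul_left, real_inner_smul_right] at h
  have h2 : ⟪A x, x⟫_ℝ = ‖x‖ ^ 2 * (‖x‖⁻¹ * (‖x‖⁻¹ * ⟪A x, x⟫_ℝ)) := by field_simp
  rw [h2, neg_neg, mul_comm]
  exact mul_le_mul_of_nonneg_right h (by positivity)

/-- The flow `exp (t A)` of a linear vector field. -/
noncomputable def linFlow (A : V →L[ℝ] V) (t : ℝ) : V →L[ℝ] V := NormedSpace.exp (t • A)

@[simp] lemma linFlow_zero (A : V →L[ℝ] V) : linFlow A 0 = 1 := by simp [linFlow]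

variable [CompleteSpace V]

lemma linFlow_add (A : V →L[ℝ] V) (s t : ℝ) (x : V) :
    linFlow A (s + t) x = linFlow A s (linFlow A t x) := by
  have hc : Commute (s • A) (t • A) := ((Commute.refl A).smul_left s).smul_right t
  let +nondep : NormedAlgebra ℚ (V →L[ℝ] V) := .restrictScalars ℚ ℝ _
  rw [linFlow, add_smul, NormedSpace.exp_add_of_commute hc]
  rfl

lemma linFlow_neg_apply (A : V →L[ℝ] V) (t : ℝ) (x : V) :
    linFlow A t (linFlow A (-t) x) = x := by
  rw [← linFlow_add]
  simp

lemma hasDerivAt_linFlow (A : V →L[ℝ] V) (t : ℝ) :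
    HasDerivAt (linFlow A) (A * linFlow A t) t :=
  hasDerivAt_exp_smul_const' A t

lemma continuous_linFlow (A : V →L[ℝ] V) : Continuous (linFlow A) :=
  continuous_iff_continuousAt.2 fun t => (hasDerivAt_linFlow A t).continuousAt

lemma norm_linFlow_apply_le {A : V →L[ℝ] V} {c : ℝ}
    (hA : ∀ x, ⟪A x, x⟫_ℝ ≤ -c * ‖x‖ ^ 2) {t : ℝ} (ht : 0 ≤ t) (x : V) :
    ‖linFlow A t x‖ ≤ Real.exp (-c * t) * ‖x‖ := by
  have hd : ∀ t, HasDerivAt (fun t => linFlow A t x) (A (linFlow A t x)) t := fun t => by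
    simpa using (hasDerivAt_linFlow A t).clm_apply (hasDerivAt_const t x)
  have hg : ∀ t, HasDerivAt (fun t => Real.exp (2 * c * t) * ‖linFlow A t x‖ ^ 2)
      (Real.exp (2 * c * t) * (2 * c) * ‖linFlow A t x‖ ^ 2 +
        Real.exp (2 * c * t) * (2 * ⟪linFlow A t x, A (linFlow A t x)⟫_ℝ)) t := fun t => by
    refine HasDerivAt.mul ?_ (hd t).norm_sq
    simpa using ((hasDerivAt_id t).const_mul (2 * c)).exp
  have hanti : Antitone fun t => Real.exp (2 * c * t) * ‖linFlow A t x‖ ^ 2 := by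
    refine antitone_of_deriv_nonpos (fun t => (hg t).differentiableAt) fun t => ?_
    rw [(hg t).deriv, real_inner_comm]
    have := mul_le_mul_of_nonneg_left (hA (linFlow A t x)) (Real.exp_pos (2 * c * t)).le
    nlinarith
  have h := hanti ht
  simp only [mul_zero, Real.exp_zero, linFlow_zero, one_mul] at h
  refine le_of_sq_le_sq ?_ (by positivity)
  have h2 : Real.exp (-c * t) ^ 2 * Real.exp (2 * c * t) = 1 := by
    rw [← Real.exp_nat_mul, ← Real.exp_add, Real.exp_eq_one_iff]
    push_cast
    ring
  calc ‖linFlow A t x‖ ^ 2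
      = Real.exp (-c * t) ^ 2 * (Real.exp (2 * c * t) * ‖linFlow A t x‖ ^ 2) := by
        rw [← mul_assoc, h2, one_mul]
    _ ≤ Real.exp (-c * t) ^ 2 * ‖x‖ ^ 2 := mul_le_mul_of_nonneg_left h (by positivity)
    _ = _ := by ring

variable {A : V →L[ℝ] V} {c : ℝ}

lemma exists_homogeneous_orbit (hc : 0 < c) (hA : ∀ x, ⟪A x, x⟫_ℝ ≤ -c * ‖x‖ ^ 2) :
    ∃ ι : V →L[ℝ] (ℝ≥0 →ᵇ V), ∀ ξ (t : ℝ≥0), ι ξ t = linFlow A t ξ := by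
  have hb : ∀ ξ (t : ℝ≥0), ‖linFlow A t ξ‖ ≤ 1 * ‖ξ‖ := fun ξ t =>
    (norm_linFlow_apply_le hA t.coe_nonneg ξ).trans (mul_le_mul_of_nonneg_right
      (Real.exp_le_one_iff.2 (by nlinarith [t.coe_nonneg])) (norm_nonneg _))
  have hcont : ∀ ξ, Continuous fun t : ℝ≥0 => linFlow A t ξ := fun ξ =>
    ((continuous_linFlow A).comp NNReal.continuous_coe).clm_apply continuous_const
  exact ⟨LinearMap.mkContinuous
    { toFun := fun ξ => BoundedContinuousFunction.ofNormedAddCommGroup _ (hcont ξ) _ (hb ξ)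
      map_add' := fun _ _ => by ext; simp
      map_smul' := fun _ _ => by ext; simp } 1
    (fun ξ => (BoundedContinuousFunction.norm_le (by positivity)).2 (hb ξ)), fun _ _ => rfl⟩

lemma continuous_linFlow_neg_apply (f : ℝ≥0 →ᵇ V) :
    Continuous fun s : ℝ => linFlow A (-s) (f s.toNNReal) :=
  ((continuous_linFlow A).comp continuous_neg).clm_apply
    (f.continuous.comp continuous_real_toNNReal)

/-- The convolution operator solving `x' = A x + f`, `x 0 = 0`. -/
lemma exists_forward_convolution (hc : 0 < c) (hA : ∀ x, ⟪A x, x⟫_ℝ ≤ -c * ‖x‖ ^ 2) :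
    ∃ K : (ℝ≥0 →ᵇ V) →L[ℝ] (ℝ≥0 →ᵇ V), ∀ f (t : ℝ≥0),
      K f t = linFlow A t (∫ s in (0 : ℝ)..t, linFlow A (-s) (f s.toNNReal)) := by
  have hii : ∀ (f : ℝ≥0 →ᵇ V) (a b : ℝ), IntervalIntegrable
      (fun s : ℝ => linFlow A (-s) (f s.toNNReal)) volume a b := fun f a b =>
    (continuous_linFlow_neg_apply f).intervalIntegrable a b
  have hb : ∀ (f : ℝ≥0 →ᵇ V) (t : ℝ≥0),
      ‖linFlow A t (∫ s in (0 : ℝ)..t, linFlow A (-s) (f s.toNNReal))‖ ≤ c⁻¹ * ‖f‖ := by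
    intro f t
    have hder : ∀ s : ℝ, HasDerivAt (fun s : ℝ => c⁻¹ * Real.exp (-c * (t - s)) * ‖f‖)
        (Real.exp (-c * (t - s)) * ‖f‖) s := fun s => by
      have h1 : HasDerivAt (fun s : ℝ => -c * (t - s)) c s := by
        simpa using ((hasDerivAt_id s).const_sub (t : ℝ)).const_mul (-c)
      exact ((h1.exp.const_mul c⁻¹).mul_const ‖f‖).congr_deriv
        (by rw [mul_comm (Real.exp _) c, inv_mul_cancel_left₀ hc.ne'])
    have hexp : Continuous fun s : ℝ => Real.exp (-c * (t - s)) * ‖f‖ := by fun_prop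
    rw [← ContinuousLinearMap.intervalIntegral_comp_comm _ (hii f 0 t)]
    refine (intervalIntegral.norm_integral_le_of_norm_le t.coe_nonneg (ae_of_all _ fun s hs => ?_)
      (hexp.intervalIntegrable 0 t)).trans ?_
    · rw [← linFlow_add, ← sub_eq_add_neg]
      exact (norm_linFlow_apply_le hA (sub_nonneg.2 hs.2) _).trans
        (mul_le_mul_of_nonneg_left (f.norm_coe_le_norm _) (Real.exp_pos _).le)
    · rw [intervalIntegral.integral_eq_sub_of_hasDerivAt (fun s _ => hder s)
        (hexp.intervalIntegrable 0 t)]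
      simp only [sub_self, mul_zero, Real.exp_zero, mul_one]
      have : 0 ≤ c⁻¹ * Real.exp (-c * (t - 0)) * ‖f‖ := by positivity
      linarith
  have hcont : ∀ f : ℝ≥0 →ᵇ V, Continuous fun t : ℝ≥0 =>
      linFlow A t (∫ s in (0 : ℝ)..t, linFlow A (-s) (f s.toNNReal)) := fun f =>
    ((continuous_linFlow A).comp NNReal.continuous_coe).clm_apply
      ((intervalIntegral.continuous_primitive (hii f) 0).comp NNReal.continuous_coe)
  exact ⟨LinearMap.mkContinuous
    { toFun := fun f => BoundedContinuousFunction.ofNormedAddCommGroup _ (hcont f) _ (hb f)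
      map_add' := fun f g => by
        ext t
        simp [intervalIntegral.integral_add (hii f 0 t) (hii g 0 t)]
      map_smul' := fun r f => by
        ext t
        simp [intervalIntegral.integral_smul] } c⁻¹
    (fun f => (BoundedContinuousFunction.norm_le (by positivity)).2 (hb f)), fun _ _ => rfl⟩

lemma integrableOn_linFlow_apply (hc : 0 < c) (hA : ∀ x, ⟪A x, x⟫_ℝ ≤ -c * ‖x‖ ^ 2)
    (f : ℝ≥0 →ᵇ V) : IntegrableOn (fun r : ℝ => linFlow A r (f r.toNNReal)) (Ioi 0) := by
  refine Integrable.mono' ((integrableOn_exp_mul_Ioi (neg_lt_zero.2 hc) 0).mul_const ‖f‖)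
    ((continuous_linFlow A).clm_apply
      (f.continuous.comp continuous_real_toNNReal)).aestronglyMeasurable ?_
  filter_upwards [ae_restrict_mem measurableSet_Ioi] with r hr
  exact (norm_linFlow_apply_le hA (le_of_lt hr) _).trans
    (mul_le_mul_of_nonneg_left (f.norm_coe_le_norm _) (Real.exp_pos _).le)

/-- Translation of a bounded continuous function on the half-line. -/
noncomputable def shift {W : Type*} [NormedAddCommGroup W] (τ : ℝ≥0) (f : ℝ≥0 →ᵇ W) : ℝ≥0 →ᵇ W :=
  f.compContinuous ⟨fun t => τ + t, by fun_prop⟩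

@[simp] lemma shift_apply {W : Type*} [NormedAddCommGroup W] (τ t : ℝ≥0) (f : ℝ≥0 →ᵇ W) :
    shift τ f t = f (τ + t) := rfl

lemma norm_shift_le {W : Type*} [NormedAddCommGroup W] (τ : ℝ≥0) (f : ℝ≥0 →ᵇ W) :
    ‖shift τ f‖ ≤ ‖f‖ :=
  (BoundedContinuousFunction.norm_le (norm_nonneg _)).2 fun _ => f.norm_coe_le_norm _

/-- The convolution operator giving (up to sign) the bounded solution of `y' = -A y + f`. -/
lemma exists_backward_convolution (hc : 0 < c) (hA : ∀ x, ⟪A x, x⟫_ℝ ≤ -c * ‖x‖ ^ 2) :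
    ∃ K : (ℝ≥0 →ᵇ V) →L[ℝ] (ℝ≥0 →ᵇ V), ∀ f (t : ℝ≥0),
      K f t = ∫ r in Ioi (0 : ℝ), linFlow A r (f (t + r.toNNReal)) := by
  have hintegrable : ∀ (f : ℝ≥0 →ᵇ V) (t : ℝ≥0),
      IntegrableOn (fun r : ℝ => linFlow A r (f (t + r.toNNReal))) (Ioi 0) := fun f t =>
    integrableOn_linFlow_apply hc hA (shift t f)
  have hexp := integrableOn_exp_mul_Ioi (neg_lt_zero.2 hc) 0
  have hle : ∀ (f : ℝ≥0 →ᵇ V) (t : ℝ≥0), ∀ᵐ r ∂(volume.restrict (Ioi (0 : ℝ))),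
      ‖linFlow A r (f (t + r.toNNReal))‖ ≤ Real.exp (-c * r) * ‖f‖ := fun f t => by
    filter_upwards [ae_restrict_mem measurableSet_Ioi] with r hr
    exact (norm_linFlow_apply_le hA (le_of_lt hr) _).trans
      (mul_le_mul_of_nonneg_left (f.norm_coe_le_norm _) (Real.exp_pos _).le)
  have hb : ∀ (f : ℝ≥0 →ᵇ V) (t : ℝ≥0),
      ‖∫ r in Ioi (0 : ℝ), linFlow A r (f (t + r.toNNReal))‖ ≤ c⁻¹ * ‖f‖ := fun f t => by
    refine (norm_integral_le_of_norm_le (hexp.mul_const ‖f‖) (hle f t)).trans_eq ?_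
    rw [integral_mul_const, integral_exp_mul_Ioi (neg_lt_zero.2 hc)]
    simp
  have hcont : ∀ f : ℝ≥0 →ᵇ V, Continuous fun t : ℝ≥0 =>
      ∫ r in Ioi (0 : ℝ), linFlow A r (f (t + r.toNNReal)) := fun f =>
    continuous_of_dominated (fun t => (hintegrable f t).aestronglyMeasurable) (hle f)
      (hexp.mul_const ‖f‖) (ae_of_all _ fun r => by fun_prop)
  exact ⟨LinearMap.mkContinuous
    { toFun := fun f => BoundedContinuousFunction.ofNormedAddCommGroup _ (hcont f) _ (hb f)
      map_add' := fun f g => by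
        ext t
        simp [integral_add (hintegrable f t) (hintegrable g t)]
      map_smul' := fun r f => by
        ext t
        simp [integral_smul] } c⁻¹
    (fun f => (BoundedContinuousFunction.norm_le (by positivity)).2 (hb f)), fun _ _ => rfl⟩

end LinearFlow
section Shift

variable {V : Type*} [NormedAddCommGroup V] [InnerProductSpace ℝ V] [CompleteSpace V]
  {A : V →L[ℝ] V}

lemma hasDerivAt_variation_of_constants {k : ℝ → V} (hk : Continuous k) (ξ : V) :
    HasDerivAt (fun τ => linFlow A τ (ξ + ∫ s in (0 : ℝ)..τ, k s)) (A ξ + k 0) 0 := by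
  have h1 : HasDerivAt (fun τ => ξ + ∫ s in (0 : ℝ)..τ, k s) (k 0) 0 :=
    (hk.integral_hasStrictDerivAt 0 0).hasDerivAt.const_add ξ
  simpa using (hasDerivAt_linFlow A 0).clm_apply h1

lemma toNNReal_add_coe {r : ℝ} (hr : 0 ≤ r) (τ : ℝ≥0) :
    (r + τ).toNNReal = τ + r.toNNReal := by
  rw [Real.toNNReal_add hr τ.coe_nonneg, Real.toNNReal_coe, add_comm]

lemma forward_convolution_shift (g : ℝ≥0 →ᵇ V) (ξ : V) (τ t : ℝ≥0) :
    linFlow A ((τ + t : ℝ≥0) : ℝ)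
        (ξ + ∫ s in (0 : ℝ)..((τ + t : ℝ≥0) : ℝ), linFlow A (-s) (g s.toNNReal)) =
      linFlow A t (linFlow A τ (ξ + ∫ s in (0 : ℝ)..τ, linFlow A (-s) (g s.toNNReal)) +
        ∫ s in (0 : ℝ)..t, linFlow A (-s) (shift τ g s.toNNReal)) := by
  have hii : ∀ a b : ℝ, IntervalIntegrable
      (fun s : ℝ => linFlow A (-s) (g s.toNNReal)) volume a b := fun a b =>
    (continuous_linFlow_neg_apply g).intervalIntegrable a b
  have h1 : ∫ s in (0 : ℝ)..t, linFlow A (-s) (shift τ g s.toNNReal) =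
      linFlow A τ (∫ s in (τ : ℝ)..((τ + t : ℝ≥0) : ℝ), linFlow A (-s) (g s.toNNReal)) := by
    have h2 := intervalIntegral.integral_comp_add_right (a := (0 : ℝ)) (b := t)
      (fun s : ℝ => linFlow A (-s) (g s.toNNReal)) (τ : ℝ)
    rw [zero_add, add_comm (t : ℝ) τ] at h2
    rw [NNReal.coe_add, ← h2, ← ContinuousLinearMap.intervalIntegral_comp_comm]
    · refine intervalIntegral.integral_congr fun s hs => ?_
      rw [uIcc_of_le t.coe_nonneg] at hs
      simp only [shift_apply, toNNReal_add_coe hs.1, ← linFlow_add]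
      congr 2
      ring
    · have := (continuous_linFlow_neg_apply (A := A) g).comp (continuous_add_const (τ : ℝ))
      exact this.intervalIntegrable _ _
  rw [h1, ← map_add, ← linFlow_add, add_assoc,
    intervalIntegral.integral_add_adjacent_intervals (hii _ _) (hii _ _), NNReal.coe_add,
    add_comm (t : ℝ) τ]

lemma backward_convolution_shift {B : V →L[ℝ] V} {c : ℝ} (hc : 0 < c)
    (hB : ∀ x, ⟪(-B) x, x⟫_ℝ ≤ -c * ‖x‖ ^ 2) (h : ℝ≥0 →ᵇ V) (τ : ℝ≥0) :
    ∫ r in Ioi (0 : ℝ), linFlow (-B) r (h (τ + r.toNNReal)) =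
      linFlow B τ ((∫ r in Ioi (0 : ℝ), linFlow (-B) r (h r.toNNReal)) -
        ∫ r in (0 : ℝ)..τ, linFlow (-B) r (h r.toNNReal)) := by
  have hi := integrableOn_linFlow_apply hc hB h
  have hflow : ∀ (t : ℝ) (x : V), linFlow B t x = linFlow (-B) (-t) x := fun t x => by
    simp [linFlow]
  rw [← intervalIntegral.integral_Ioi_sub_Ioi hi τ.coe_nonneg, sub_sub_cancel]
  have h1 := (measurePreserving_add_right volume (τ : ℝ)).setIntegral_preimage_emb
    (measurableEmbedding_addRight (τ : ℝ)) (fun r : ℝ => linFlow (-B) r (h r.toNNReal)) (Ioi τ)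
  have hi' : IntegrableOn (fun r : ℝ => linFlow (-B) (r + τ) (h (r + τ).toNNReal)) (Ioi 0) := by
    have := ((measurePreserving_add_right volume (τ : ℝ)).integrableOn_comp_preimage
      (measurableEmbedding_addRight (τ : ℝ))).2 (hi.mono_set (Ioi_subset_Ioi τ.coe_nonneg))
    rw [preimage_add_const_Ioi, sub_self] at this
    exact this
  rw [preimage_add_const_Ioi, sub_self] at h1
  rw [← h1, ← ContinuousLinearMap.integral_comp_comm _ hi']
  refine setIntegral_congr_fun measurableSet_Ioi fun r hr => ?_
  simp only [toNNReal_add_coe (le_of_lt hr), hflow, ← linFlow_add]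
  congr 2
  ring

end Shift

/-- The stable manifold theorem: a smooth vector field with hyperbolic linear part `A ⊕ B` has a
smooth locally invariant graph over the stable subspace, tangent to it at the origin. -/
lemma exists_stable_manifold {V W : Type v}
    [NormedAddCommGroup V] [InnerProductSpace ℝ V] [FiniteDimensional ℝ V]
    [NormedAddCommGroup W] [InnerProductSpace ℝ W] [FiniteDimensional ℝ W]
    (A : V →L[ℝ] V) (hA : ∀ x, x ≠ 0 → ⟪A x, x⟫_ℝ < 0)
    (B : W →L[ℝ] W) (hB : ∀ y, y ≠ 0 → 0 < ⟪B y, y⟫_ℝ)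
    (F : V × W → V × W) (hF : ContDiff ℝ (⊤ : ℕ∞) F) (hF0 : F 0 = 0) (hDF0 : fderiv ℝ F 0 = 0) :
    ∃ (U : Set V) (w : V → W), IsOpen U ∧ 0 ∈ U ∧ ContDiffOn ℝ (⊤ : ℕ∞) w U ∧ w 0 = 0 ∧
      HasFDerivAt w (0 : V →L[ℝ] W) 0 ∧
      ∀ x ∈ U, fderiv ℝ w x (A x + (F (x, w x)).1) = B (w x) + (F (x, w x)).2 := by
  have : CompleteSpace V := FiniteDimensional.complete ℝ V
  have : CompleteSpace W := FiniteDimensional.complete ℝ W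
  have : ProperSpace (V × W) := FiniteDimensional.proper_real _
  obtain ⟨a, ha, hAa⟩ := exists_inner_le_neg_mul_sq A hA
  obtain ⟨b, hb, hBb⟩ := exists_inner_le_neg_mul_sq (-B) fun y hy => by simpa using hB y hy
  obtain ⟨ι, hι⟩ := exists_homogeneous_orbit ha hAa
  obtain ⟨K₁, hK₁⟩ := exists_forward_convolution ha hAa
  obtain ⟨K₂, hK₂⟩ := exists_backward_convolution hb hBb
  let P₁ := (ContinuousLinearMap.fst ℝ V W).compLeftContinuousBounded ℝ≥0
  let P₂ := (ContinuousLinearMap.snd ℝ V W).compLeftContinuousBounded ℝ≥0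
  let J₁ := (ContinuousLinearMap.inl ℝ V W).compLeftContinuousBounded ℝ≥0
  let J₂ := (ContinuousLinearMap.inr ℝ V W).compLeftContinuousBounded ℝ≥0
  let N : (ℝ≥0 →ᵇ V × W) → (ℝ≥0 →ᵇ V × W) := superpos F hF.continuous
  let K : (ℝ≥0 →ᵇ V × W) →L[ℝ] (ℝ≥0 →ᵇ V × W) := J₁ ∘L K₁ ∘L P₁ - J₂ ∘L K₂ ∘L P₂
  let j : V →L[ℝ] (ℝ≥0 →ᵇ V × W) := J₁ ∘L ι
  let Φ : (ℝ≥0 →ᵇ V × W) → (ℝ≥0 →ᵇ V × W) := fun z => z - K (N z)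
  have hNshift : ∀ τ z, N (shift τ z) = shift τ (N z) := fun _ _ => rfl
  have hPshift₁ : ∀ τ z, P₁ (shift τ z) = shift τ (P₁ z) := fun _ _ => rfl
  have hfix : ∀ z ξ, Φ z = j ξ ↔ ∀ t : ℝ≥0,
      (z t).1 = linFlow A t (ξ + ∫ s in (0 : ℝ)..t, linFlow A (-s) (P₁ (N z) s.toNNReal)) ∧
      (z t).2 = -∫ r in Ioi (0 : ℝ), linFlow (-B) r (P₂ (N z) (t + r.toNNReal)) := by
    intro z ξ
    rw [DFunLike.ext_iff]
    refine forall_congr' fun t => ?_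
    have h1 : Φ z t = z t - (K₁ (P₁ (N z)) t, -K₂ (P₂ (N z)) t) := by
      change z t - (((K₁ (P₁ (N z)) t, 0) : V × W) - (0, K₂ (P₂ (N z)) t)) = _
      simp
    have h2 : j ξ t = (ι ξ t, 0) := rfl
    rw [h1, h2, hK₁, hK₂, hι, Prod.ext_iff, map_add]
    simp only [Prod.fst_sub, Prod.snd_sub, sub_eq_iff_eq_add, zero_add]
  have hN0 : N 0 = 0 := by
    ext1 t
    exact hF0
  have hΦ0 : Φ 0 = 0 := by simp [Φ, hN0]
  have hΦ : ContDiff ℝ (⊤ : ℕ∞) Φ :=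
    contDiff_id.sub (K.contDiff.comp (contDiff_superpos F hF))
  have hΦ' : HasFDerivAt Φ (ContinuousLinearMap.id ℝ (ℝ≥0 →ᵇ V × W)) 0 := by
    have h1 := hasFDerivAt_superpos F (hF.of_le (by exact_mod_cast le_top)) (0 : ℝ≥0 →ᵇ V × W)
    have h2 : superpos (fderiv ℝ F) ((hF.of_le (by exact_mod_cast le_top)).continuous_fderiv
        one_ne_zero) (0 : ℝ≥0 →ᵇ V × W) = 0 := by
      ext1 t
      exact hDF0
    rw [h2, map_zero] at h1
    have h3 := (hasFDerivAt_id (0 : ℝ≥0 →ᵇ V × W)).sub (K.hasFDerivAt.comp 0 h1)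
    rw [ContinuousLinearMap.comp_zero, sub_zero] at h3
    exact h3
  obtain ⟨e, heΦ, h0s, -, hes, hed⟩ :=
    exists_smooth_local_inverse isOpen_univ (mem_univ 0) hΦ.contDiffOn hΦ0 hΦ'
  obtain ⟨r, hr, hrs⟩ := Metric.isOpen_iff.1 e.open_source 0 h0s
  have h0t : (0 : ℝ≥0 →ᵇ V × W) ∈ e.target := by
    have := e.map_source h0s
    rwa [heΦ, hΦ0] at this
  have he0 : e.symm 0 = 0 := by
    have := e.left_inv h0s
    rwa [heΦ, hΦ0] at this
  let U : Set V := j ⁻¹' (e.target ∩ e.symm ⁻¹' Metric.ball 0 r)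
  have hU : IsOpen U := (e.symm.isOpen_inter_preimage Metric.isOpen_ball).preimage j.continuous
  let ev : (ℝ≥0 →ᵇ V × W) →L[ℝ] W :=
    (ContinuousLinearMap.snd ℝ V W) ∘L BoundedContinuousFunction.evalCLM ℝ 0
  let w : V → W := fun ξ => ev (e.symm (j ξ))
  have hw : ContDiffOn ℝ (⊤ : ℕ∞) w U :=
    ev.contDiff.comp_contDiffOn (hes.comp j.contDiff.contDiffOn fun ξ hξ => hξ.1)
  have hw0 : w 0 = 0 := by simp [w, he0]
  refine ⟨U, w, hU, ⟨by simpa using h0t, by simp [he0, hr]⟩, hw, hw0, ?_, fun ξ hξ => ?_⟩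
  · have h1 : HasFDerivAt e.symm (ContinuousLinearMap.id ℝ (ℝ≥0 →ᵇ V × W)) (j 0) := by
      rwa [map_zero]
    have h2 : HasFDerivAt w (ev ∘L ContinuousLinearMap.id ℝ _ ∘L j) 0 :=
      ev.hasFDerivAt.comp 0 (h1.comp 0 j.hasFDerivAt)
    refine h2.congr_fderiv ?_
    ext ξ
    rfl
  · set z := e.symm (j ξ) with hz
    have hzr : ‖z‖ < r := by simpa using hξ.2
    have hΦz : Φ z = j ξ := heΦ ▸ e.right_inv hξ.1
    have hzfix := (hfix z ξ).1 hΦz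
    let x : ℝ → V := fun τ =>
      linFlow A τ (ξ + ∫ s in (0 : ℝ)..τ, linFlow A (-s) (P₁ (N z) s.toNNReal))
    let y : ℝ → W := fun τ =>
      linFlow B τ (w ξ + ∫ s in (0 : ℝ)..τ, linFlow (-B) s (P₂ (N z) s.toNNReal))
    have hx0 : x 0 = ξ := by simp [x]
    have hz0 : z 0 = (ξ, w ξ) := Prod.ext ((hzfix 0).1.trans hx0) rfl
    have hwξ : w ξ = -∫ r in Ioi (0 : ℝ), linFlow (-B) r (P₂ (N z) r.toNNReal) := by
      have := (hzfix 0).2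
      simp only [zero_add] at this
      exact this
    have hxd : HasDerivAt x (A ξ + (F (ξ, w ξ)).1) 0 := by
      have := hasDerivAt_variation_of_constants (A := A)
        (continuous_linFlow_neg_apply (A := A) (P₁ (N z))) ξ
      convert this using 2
      rw [← hz0]
      simp [P₁, N]
    have hyd : HasDerivAt y (B (w ξ) + (F (ξ, w ξ)).2) 0 := by
      have hk : Continuous fun s : ℝ => linFlow (-B) s (P₂ (N z) s.toNNReal) :=
        (continuous_linFlow (-B)).clm_apply
          ((P₂ (N z)).continuous.comp continuous_real_toNNReal)
      have := hasDerivAt_variation_of_constants (A := B) hk (w ξ)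
      convert this using 2
      rw [← hz0]
      simp [P₂, N]
    have hinv : ∀ τ ∈ Ici (0 : ℝ), w (x τ) = y τ := by
      intro τ' hτ'
      lift τ' to ℝ≥0 using hτ'
      have h1 : Φ (shift τ' z) = j (x τ') := by
        refine (hfix _ _).2 fun t => ⟨?_, ?_⟩
        · rw [shift_apply, (hzfix _).1, hNshift, hPshift₁]
          exact forward_convolution_shift _ _ _ _
        · rw [shift_apply, (hzfix _).2]
          simp only [add_assoc]
          rfl
      have h2 : shift τ' z ∈ e.source :=
        hrs (by simpa using (norm_shift_le τ' z).trans_lt hzr)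
      have h3 : e.symm (j (x τ')) = shift τ' z := by
        rw [← h1, ← heΦ, e.left_inv h2]
      have h4 : w (x τ') = (z τ').2 := by
        change ev (e.symm (j (x τ'))) = _
        rw [h3]
        change (z (τ' + 0)).2 = _
        rw [add_zero]
      rw [h4, (hzfix τ').2, backward_convolution_shift hb hBb, ← map_neg, neg_sub',
        sub_neg_eq_add, ← hwξ]
    have hwd : HasFDerivAt w (fderiv ℝ w ξ) (x 0) := by
      rw [hx0]
      exact ((hw.contDiffAt (hU.mem_nhds hξ)).differentiableAt (by simp)).hasFDerivAt
    exact (uniqueDiffOn_Ici (0 : ℝ) 0 self_mem_Ici).eq_deriv _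
      (hwd.comp_hasDerivAt 0 hxd).hasDerivWithinAt
      (hyd.hasDerivWithinAt.congr hinv (hinv 0 self_mem_Ici))

/-- A vector field tangent to the graphs of `w` over `V` and of `v` over `W` takes, in the
coordinates `(x - v y, y - w x)`, a form that leaves both factors invariant. -/
lemma exists_straightening {V W : Type v}
    [NormedAddCommGroup V] [InnerProductSpace ℝ V] [FiniteDimensional ℝ V]
    [NormedAddCommGroup W] [InnerProductSpace ℝ W] [FiniteDimensional ℝ W]
    (A : V →L[ℝ] V) (hA : ∀ x, x ≠ 0 → ⟪A x, x⟫_ℝ < 0)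
    (B : W →L[ℝ] W) (hB : ∀ y, y ≠ 0 → 0 < ⟪B y, y⟫_ℝ)
    (F : V × W → V × W) (hF : ContDiff ℝ (⊤ : ℕ∞) F) (hF0 : F 0 = 0) (hDF0 : fderiv ℝ F 0 = 0) :
    ∃ (e : OpenPartialHomeomorph (V × W) (V × W)) (f : V × W → V →L[ℝ] V) (g : V × W → W →L[ℝ] W),
      0 ∈ e.source ∧ e 0 = 0 ∧ ContDiffOn ℝ (⊤ : ℕ∞) e e.source ∧
      ContDiffOn ℝ (⊤ : ℕ∞) e.symm e.target ∧ ContDiffOn ℝ (⊤ : ℕ∞) f e.target ∧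
      ContDiffOn ℝ (⊤ : ℕ∞) g e.target ∧ f 0 = 0 ∧ g 0 = 0 ∧
      ∀ q ∈ e.target, fderiv ℝ e (e.symm q) ((A (e.symm q).1, B (e.symm q).2) + F (e.symm q)) =
        (A q.1 + f q q.1, B q.2 + g q q.2) := by
  have : CompleteSpace V := FiniteDimensional.complete ℝ V
  have : CompleteSpace W := FiniteDimensional.complete ℝ W
  have : ProperSpace (V × W) := FiniteDimensional.proper_real _
  obtain ⟨U, w, hU, h0U, hw, hw0, hDw0, hwinv⟩ := exists_stable_manifold A hA B hB F hF hF0 hDF0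
  obtain ⟨U', v, hU', h0U', hv, hv0, hDv0, hvinv⟩ :
      ∃ (U : Set W) (v : W → V), IsOpen U ∧ 0 ∈ U ∧ ContDiffOn ℝ (⊤ : ℕ∞) v U ∧ v 0 = 0 ∧
        HasFDerivAt v (0 : W →L[ℝ] V) 0 ∧
        ∀ y ∈ U, fderiv ℝ v y (B y + (F (v y, y)).2) = A (v y) + (F (v y, y)).1 := by
    let σ := ContinuousLinearEquiv.prodComm ℝ W V
    have hσF : HasFDerivAt (fun p => -(σ.symm (F (σ p)))) (0 : W × V →L[ℝ] W × V) 0 := by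
      have h1 : HasFDerivAt F (0 : V × W →L[ℝ] V × W) (σ 0) := by
        rw [map_zero, ← hDF0]
        exact (hF.differentiable (by simp) 0).hasFDerivAt
      have h2 := (σ.symm.hasFDerivAt.comp 0 (h1.comp 0 σ.hasFDerivAt)).neg
      rw [ContinuousLinearMap.zero_comp, ContinuousLinearMap.comp_zero, neg_zero] at h2
      exact h2
    obtain ⟨U, v, hU, h0U, hv, hv0, hDv0, hinv⟩ := exists_stable_manifold (-B)
      (fun y hy => by simpa using hB y hy) (-A) (fun x hx => by simpa using hA x hx)
      (fun p => -(σ.symm (F (σ p))))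
      (σ.symm.contDiff.comp (hF.comp σ.contDiff)).neg (by simp [hF0]) hσF.fderiv
    refine ⟨U, v, hU, h0U, hv, hv0, hDv0, fun y hy => neg_injective ?_⟩
    have h1 := hinv y hy
    rw [← map_neg, neg_add, neg_add]
    exact h1
  have hwd : ∀ x ∈ U, HasFDerivAt w (fderiv ℝ w x) x := fun x hx =>
    ((hw.contDiffAt (hU.mem_nhds hx)).differentiableAt (by simp)).hasFDerivAt
  have hvd : ∀ y ∈ U', HasFDerivAt v (fderiv ℝ v y) y := fun y hy =>
    ((hv.contDiffAt (hU'.mem_nhds hy)).differentiableAt (by simp)).hasFDerivAt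
  let Φ : V × W → V × W := fun p => (p.1 - v p.2, p.2 - w p.1)
  let π₁ := ContinuousLinearMap.fst ℝ V W
  let π₂ := ContinuousLinearMap.snd ℝ V W
  have hΦd : ∀ p ∈ U ×ˢ U', HasFDerivAt Φ
      ((π₁ - fderiv ℝ v p.2 ∘L π₂).prod (π₂ - fderiv ℝ w p.1 ∘L π₁)) p := fun p hp =>
    (π₁.hasFDerivAt.sub ((hvd _ hp.2).comp p π₂.hasFDerivAt)).prodMk
      (π₂.hasFDerivAt.sub ((hwd _ hp.1).comp p π₁.hasFDerivAt))
  have hw' : ContDiffOn ℝ (⊤ : ℕ∞) (fun p : V × W => w p.1) (U ×ˢ U') :=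
    hw.comp contDiffOn_fst fun p hp => hp.1
  have hv' : ContDiffOn ℝ (⊤ : ℕ∞) (fun p : V × W => v p.2) (U ×ˢ U') :=
    hv.comp contDiffOn_snd fun p hp => hp.2
  have hΦ : ContDiffOn ℝ (⊤ : ℕ∞) Φ (U ×ˢ U') :=
    (contDiffOn_fst.sub hv').prodMk (contDiffOn_snd.sub hw')
  have hΦ0 : Φ 0 = 0 := by simp [Φ, hw0, hv0]
  have hΦ' : HasFDerivAt Φ (ContinuousLinearMap.id ℝ (V × W)) 0 := by
    refine (hΦd 0 ⟨h0U, h0U'⟩).congr_fderiv ?_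
    simp only [Prod.fst_zero, Prod.snd_zero, hDv0.fderiv, hDw0.fderiv,
      ContinuousLinearMap.zero_comp, sub_zero]
    rfl
  obtain ⟨e, heΦ, h0s, hsU, hes, -⟩ :=
    exists_smooth_local_inverse (hU.prod hU') ⟨h0U, h0U'⟩ hΦ hΦ0 hΦ'
  have hmem : ∀ q ∈ e.target, e.symm q ∈ U ×ˢ U' := fun q hq => hsU (e.map_target hq)
  have he0 : e.symm 0 = 0 := by
    have := e.left_inv h0s
    rwa [heΦ, hΦ0] at this
  obtain ⟨M, hM, hMsub, hMdiag⟩ := exists_contDiff_hadamard F hF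
  have hfst : ContDiffOn ℝ (⊤ : ℕ∞) (fun q => (e.symm q).1) e.target :=
    contDiff_fst.comp_contDiffOn hes
  have hsnd : ContDiffOn ℝ (⊤ : ℕ∞) (fun q => (e.symm q).2) e.target :=
    contDiff_snd.comp_contDiffOn hes
  have hwψ := hw.comp hfst fun q hq => (hmem q hq).1
  have hvψ := hv.comp hsnd fun q hq => (hmem q hq).2
  have hDwψ : ContDiffOn ℝ (⊤ : ℕ∞) (fun q => fderiv ℝ w (e.symm q).1) e.target :=
    (hw.fderiv_of_isOpen hU (m := (⊤ : ℕ∞)) (by simp)).comp hfst fun q hq => (hmem q hq).1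
  have hDvψ : ContDiffOn ℝ (⊤ : ℕ∞) (fun q => fderiv ℝ v (e.symm q).2) e.target :=
    (hv.fderiv_of_isOpen hU' (m := (⊤ : ℕ∞)) (by simp)).comp hsnd fun q hq => (hmem q hq).2
  let f : V × W → V →L[ℝ] V := fun q =>
    (π₁ - fderiv ℝ v (e.symm q).2 ∘L π₂) ∘L
      M ((v (e.symm q).2, (e.symm q).2), e.symm q) ∘L ContinuousLinearMap.inl ℝ V W
  let g : V × W → W →L[ℝ] W := fun q =>
    (π₂ - fderiv ℝ w (e.symm q).1 ∘L π₁) ∘L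
      M (((e.symm q).1, w (e.symm q).1), e.symm q) ∘L ContinuousLinearMap.inr ℝ V W
  have hM0 : M 0 = 0 := (hMdiag 0).trans hDF0
  refine ⟨e, f, g, h0s, heΦ ▸ hΦ0, heΦ ▸ hΦ.mono hsU, hes, ?_, ?_, ?_, ?_, fun q hq => ?_⟩
  · exact (contDiffOn_const.sub (hDvψ.clm_comp contDiffOn_const)).clm_comp
      ((hM.comp_contDiffOn ((hvψ.prodMk hsnd).prodMk hes)).clm_comp contDiffOn_const)
  · exact (contDiffOn_const.sub (hDwψ.clm_comp contDiffOn_const)).clm_comp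
      ((hM.comp_contDiffOn ((hfst.prodMk hwψ).prodMk hes)).clm_comp contDiffOn_const)
  · simp only [f, he0, Prod.snd_zero, hv0, Prod.mk_zero_zero, hM0, ContinuousLinearMap.zero_comp,
      ContinuousLinearMap.comp_zero]
  · simp only [g, he0, Prod.fst_zero, hw0, Prod.mk_zero_zero, hM0, ContinuousLinearMap.zero_comp,
      ContinuousLinearMap.comp_zero]
  · have hp := hmem q hq
    have hq' : Φ (e.symm q) = q := heΦ ▸ e.right_inv hq
    rw [heΦ, (hΦd _ hp).fderiv]
    simp only [f, g]
    generalize e.symm q = p at hp hq'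
    obtain ⟨x, y⟩ := p
    subst hq'
    have h1 := hvinv y hp.2
    have h2 := hwinv x hp.1
    have h3 := hMsub (v y, y) (x, y)
    have h4 := hMsub (x, w x) (x, y)
    simp only [Prod.mk_sub_mk, sub_self] at h3 h4
    refine Prod.ext ?_ ?_
    · simp only [Φ, ContinuousLinearMap.comp_apply, ContinuousLinearMap.inl_apply, ← h3]
      simp only [π₁, π₂, ContinuousLinearMap.prod_apply, sub_apply, ContinuousLinearMap.coe_fst',
        ContinuousLinearMap.coe_snd', ContinuousLinearMap.comp_apply, Prod.fst_add,
        map_add, map_sub]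
      rw [map_add, eq_comm, ← sub_eq_zero] at h1
      rw [← sub_eq_zero, ← h1]
      abel
    · simp only [Φ, ContinuousLinearMap.comp_apply, ContinuousLinearMap.inr_apply, ← h4]
      simp only [π₁, π₂, ContinuousLinearMap.prod_apply, sub_apply, ContinuousLinearMap.coe_fst',
        ContinuousLinearMap.coe_snd', ContinuousLinearMap.comp_apply, Prod.snd_add,
        map_add, map_sub]
      rw [map_add, eq_comm, ← sub_eq_zero] at h2
      rw [← sub_eq_zero, ← h2]
      abel

lemma matCLM_toEuclideanLin_symm {n : ℕ}
    (T : EuclideanSpace ℝ (Fin n) →L[ℝ] EuclideanSpace ℝ (Fin n)) :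
    matCLM (Matrix.toEuclideanLin.symm T.toLinearMap) = T := by
  ext1 x
  simp [matCLM]

end Straightening

/-- **Straightening coordinates.** The vector field `X p = L p + F p`, with `L = L⁻ ⊕ L⁺` block
diagonal (L⁻ symmetric negative definite, L⁺ symmetric positive definite) and `F` smooth with
`F 0 = 0`, `DF 0 = 0`, can be brought by a smooth diffeomorphism `φ` near the origin to the form
`Y (x, y) = (L⁻ x + f̃(x,y) x, L⁺ y + g̃(x,y) y)` with `f̃, g̃` smooth and vanishing at `0`. -/
theorem stmt_2 {s u : ℕ} (hs : 1 ≤ s) (hu : 1 ≤ u)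
    (Lm : Matrix (Fin s) (Fin s) ℝ) (Lp : Matrix (Fin u) (Fin u) ℝ)
    (hLmsymm : Lm.IsSymm) (hLpsymm : Lp.IsSymm)
    (hLmneg : ∀ x : EuclideanSpace ℝ (Fin s), x ≠ 0 → ⟪matCLM Lm x, x⟫_ℝ < 0)
    (hLppos : ∀ y : EuclideanSpace ℝ (Fin u), y ≠ 0 → 0 < ⟪matCLM Lp y, y⟫_ℝ)
    (F : EuclideanSpace ℝ (Fin s) × EuclideanSpace ℝ (Fin u) →
      EuclideanSpace ℝ (Fin s) × EuclideanSpace ℝ (Fin u))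
    (hF : ContDiff ℝ (⊤ : ℕ∞) F) (hF0 : F 0 = 0) (hDF0 : fderiv ℝ F 0 = 0) :
    ∃ (Ω Ω' : Set (EuclideanSpace ℝ (Fin s) × EuclideanSpace ℝ (Fin u)))
      (φ ψ : EuclideanSpace ℝ (Fin s) × EuclideanSpace ℝ (Fin u) →
        EuclideanSpace ℝ (Fin s) × EuclideanSpace ℝ (Fin u))
      (ft : EuclideanSpace ℝ (Fin s) × EuclideanSpace ℝ (Fin u) → Matrix (Fin s) (Fin s) ℝ)
      (gt : EuclideanSpace ℝ (Fin s) × EuclideanSpace ℝ (Fin u) → Matrix (Fin u) (Fin u) ℝ),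
      IsOpen Ω ∧ IsOpen Ω' ∧ (0 : _) ∈ Ω ∧ (0 : _) ∈ Ω' ∧
      ContDiffOn ℝ (⊤ : ℕ∞) φ Ω ∧ ContDiffOn ℝ (⊤ : ℕ∞) ψ Ω' ∧
      φ '' Ω = Ω' ∧ (∀ p ∈ Ω, ψ (φ p) = p) ∧ (∀ q ∈ Ω', φ (ψ q) = q) ∧
      φ 0 = 0 ∧
      ContDiffOn ℝ (⊤ : ℕ∞) (fun q => matCLM (ft q)) Ω' ∧
      ContDiffOn ℝ (⊤ : ℕ∞) (fun q => matCLM (gt q)) Ω' ∧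
      ft 0 = 0 ∧ gt 0 = 0 ∧
      (∀ q ∈ Ω',
        fderiv ℝ φ (ψ q)
            ((matCLM Lm (ψ q).1, matCLM Lp (ψ q).2) + F (ψ q)) =
          (matCLM Lm q.1 + matCLM (ft q) q.1, matCLM Lp q.2 + matCLM (gt q) q.2)) := by
  obtain ⟨e, f, g, h0, he0, he, hes, hf, hg, hf0, hg0, hY⟩ :=
    exists_straightening (matCLM Lm) hLmneg (matCLM Lp) hLppos F hF hF0 hDF0
  refine ⟨e.source, e.target, e, e.symm, fun q => Matrix.toEuclideanLin.symm (f q).toLinearMap,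
    fun q => Matrix.toEuclideanLin.symm (g q).toLinearMap, e.open_source, e.open_target, h0,
    he0 ▸ e.map_source h0, he, hes, e.image_source_eq_target, fun p => e.left_inv,
    fun q => e.right_inv, he0, ?_, ?_, by simp [hf0], by simp [hg0], fun q hq => ?_⟩
  · simpa only [matCLM_toEuclideanLin_symm] using hf
  · simpa only [matCLM_toEuclideanLin_symm] using hg
  · simpa only [matCLM_toEuclideanLin_symm] using hY q hq
end

section
/- Uniform travel-time bound: Assume hypothesis H(α,δ,ε) with 0 ≤ δ < α. Let 0 < γ ≤ ε and let (x, y) : [0,τ] → ℝ^s × ℝ^u be a C¹ solution of the straightened system taking values in C_{2ε} with ‖x(0)‖ ≤ ε and ‖x(τ)‖ ≥ γ. Then τ ≤ (1/(α-δ))·log(ε/γ). -/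
open Set
open scoped InnerProductSpace

/-- Exponential decay of a curve whose velocity satisfies a one-sided dissipativity estimate. -/
theorem norm_mul_exp_le_of_inner_deriv_le {E : Type*} [NormedAddCommGroup E]
    [InnerProductSpace ℝ E] {k τ : ℝ} (hτ : 0 ≤ τ) {x x' : ℝ → E}
    (hx : ∀ t ∈ Icc (0 : ℝ) τ, HasDerivWithinAt x (x' t) (Icc 0 τ) t)
    (hk : ∀ t ∈ Icc (0 : ℝ) τ, ⟪x t, x' t⟫_ℝ ≤ -k * ‖x t‖ ^ 2) :
    ‖x τ‖ * Real.exp (k * τ) ≤ ‖x 0‖ := by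
  have hd : ∀ t ∈ Icc (0 : ℝ) τ, HasDerivWithinAt
      (fun r => ‖x r‖ ^ 2 * Real.exp (2 * k * r))
      (2 * ⟪x t, x' t⟫_ℝ * Real.exp (2 * k * t) +
        ‖x t‖ ^ 2 * (Real.exp (2 * k * t) * (2 * k * 1))) (Icc 0 τ) t := fun t ht =>
    (hx t ht).norm_sq.mul ((((hasDerivAt_id t).const_mul (2 * k)).exp).hasDerivWithinAt)
  have hanti : AntitoneOn (fun r => ‖x r‖ ^ 2 * Real.exp (2 * k * r)) (Icc 0 τ) := by
    refine antitoneOn_of_hasDerivWithinAt_nonpos (convex_Icc 0 τ)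
      (fun t ht => (hd t ht).continuousWithinAt)
      (fun t ht => (hd t (interior_subset ht)).mono interior_subset) fun t ht => ?_
    have h := hk t (interior_subset ht)
    nlinarith [mul_nonneg (Real.exp_nonneg (2 * k * t)) (sub_nonneg.2 h)]
  have h := hanti (left_mem_Icc.2 hτ) (right_mem_Icc.2 hτ) hτ
  refine (sq_le_sq₀ (by positivity) (norm_nonneg _)).1 ?_
  rw [mul_pow, ← Real.exp_nat_mul]
  simpa [mul_assoc] using h

/-- **Uniform travel-time bound.** -/
theorem stmt_6 {s u : ℕ} (hs : 1 ≤ s) (hu : 1 ≤ u)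
    (Lm : Matrix (Fin s) (Fin s) ℝ) (Lp : Matrix (Fin u) (Fin u) ℝ)
    (hLmsymm : Lm.IsSymm) (hLpsymm : Lp.IsSymm)
    (ft : EuclideanSpace ℝ (Fin s) × EuclideanSpace ℝ (Fin u) → Matrix (Fin s) (Fin s) ℝ)
    (gt : EuclideanSpace ℝ (Fin s) × EuclideanSpace ℝ (Fin u) → Matrix (Fin u) (Fin u) ℝ)
    (hft : ContDiff ℝ 1 fun p => matCLM (ft p))
    (hgt : ContDiff ℝ 1 fun p => matCLM (gt p))
    (α δ ε : ℝ) (hδ : 0 ≤ δ) (hδα : δ < α) (hε : 0 < ε)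
    (hLm : ∀ x : EuclideanSpace ℝ (Fin s), ⟪matCLM Lm x, x⟫_ℝ ≤ -α * ‖x‖ ^ 2)
    (hLp : ∀ y : EuclideanSpace ℝ (Fin u), α * ‖y‖ ^ 2 ≤ ⟪matCLM Lp y, y⟫_ℝ)
    (hftδ : ∀ x y, max ‖x‖ ‖y‖ ≤ 2 * ε → ‖matCLM (ft (x, y))‖ ≤ δ)
    (hgtδ : ∀ x y, max ‖x‖ ‖y‖ ≤ 2 * ε → ‖matCLM (gt (x, y))‖ ≤ δ)
    (γ : ℝ) (hγ : 0 < γ) (hγε : γ ≤ ε)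
    (τ : ℝ) (hτ : 0 ≤ τ)
    (x : ℝ → EuclideanSpace ℝ (Fin s)) (y : ℝ → EuclideanSpace ℝ (Fin u))
    (hx : ∀ t ∈ Icc (0 : ℝ) τ,
      HasDerivWithinAt x (matCLM Lm (x t) + matCLM (ft (x t, y t)) (x t)) (Icc 0 τ) t)
    (hy : ∀ t ∈ Icc (0 : ℝ) τ,
      HasDerivWithinAt y (matCLM Lp (y t) + matCLM (gt (x t, y t)) (y t)) (Icc 0 τ) t)
    (hvals : ∀ t ∈ Icc (0 : ℝ) τ, max ‖x t‖ ‖y t‖ ≤ 2 * ε)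
    (hx0 : ‖x 0‖ ≤ ε) (hxτ : γ ≤ ‖x τ‖) :
    τ ≤ (1 / (α - δ)) * Real.log (ε / γ) := by
  have hdecay : ‖x τ‖ * Real.exp ((α - δ) * τ) ≤ ‖x 0‖ := by
    refine norm_mul_exp_le_of_inner_deriv_le hτ hx fun t ht => ?_
    have h₁ := hLm (x t)
    have h₂ : ⟪x t, matCLM (ft (x t, y t)) (x t)⟫_ℝ ≤ ‖x t‖ * (δ * ‖x t‖) :=
      (real_inner_le_norm _ _).trans <| mul_le_mul_of_nonneg_left
        ((matCLM (ft (x t, y t))).le_of_opNorm_le (hftδ _ _ (hvals t ht)) _) (norm_nonneg _)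
    rw [inner_add_right, real_inner_comm]
    linarith
  have hexp : Real.exp ((α - δ) * τ) ≤ ε / γ := by
    rw [le_div_iff₀' hγ]
    exact (mul_le_mul_of_nonneg_right hxτ (Real.exp_nonneg _)).trans (hdecay.trans hx0)
  have hlog := (Real.le_log_iff_exp_le (div_pos hε hγ)).2 hexp
  rw [one_div, ← div_eq_inv_mul, le_div_iff₀' (sub_pos.2 hδα)]
  exact hlog
end

section
/- Continuity of the Dulac map near the stable manifold: Assume hypothesis H(α,δ,ε) with 0 ≤ δ < α. Then for every γ with 0 < γ ≤ ε there exists γ₀ with 0 < γ₀ ≤ ε such that: whenever (x, y) : [0,τ] → C_ε is a C¹ solution of the straightened system with ‖x(0)‖ = ε, ‖y(0)‖ ≤ γ₀ and ‖y(τ)‖ = ε, one has ‖x(τ)‖ ≤ γ. -/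
open Set
open scoped InnerProductSpace

/-- If `z` satisfies the one-sided bound `⟪z, z'⟫ ≤ k‖z‖²` on `[0, τ]`, then its norm grows at most
like `exp (k t)`. -/
theorem norm_le_mul_exp_of_inner_deriv_le_s7 {E : Type*} [NormedAddCommGroup E]
    [InnerProductSpace ℝ E] {z z' : ℝ → E} {τ k : ℝ} (hτ : 0 ≤ τ)
    (hz : ∀ t ∈ Icc (0 : ℝ) τ, HasDerivWithinAt z (z' t) (Icc 0 τ) t)
    (hk : ∀ t ∈ Icc (0 : ℝ) τ, ⟪z t, z' t⟫_ℝ ≤ k * ‖z t‖ ^ 2) :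
    ‖z τ‖ ≤ ‖z 0‖ * Real.exp (k * τ) := by
  have hder : ∀ t ∈ Icc (0 : ℝ) τ,
      HasDerivWithinAt (fun t => ‖z t‖ ^ 2 * Real.exp (-(2 * k) * t))
        (2 * ⟪z t, z' t⟫_ℝ * Real.exp (-(2 * k) * t) +
          ‖z t‖ ^ 2 * (Real.exp (-(2 * k) * t) * (-(2 * k) * 1))) (Icc 0 τ) t := fun t ht =>
    (hz t ht).norm_sq.mul (((hasDerivAt_id t).const_mul (-(2 * k))).exp.hasDerivWithinAt)
  have hanti : AntitoneOn (fun t => ‖z t‖ ^ 2 * Real.exp (-(2 * k) * t)) (Icc 0 τ) := by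
    refine antitoneOn_of_hasDerivWithinAt_nonpos (convex_Icc 0 τ)
      (fun t ht => (hder t ht).continuousWithinAt)
      (fun t ht => (hder t (interior_subset ht)).mono interior_subset) fun t ht => ?_
    nlinarith [hk t (interior_subset ht), Real.exp_pos (-(2 * k) * t)]
  have h := hanti (left_mem_Icc.2 hτ) (right_mem_Icc.2 hτ) hτ
  simp only [mul_zero, Real.exp_zero, mul_one] at h
  refine (sq_le_sq₀ (by positivity) (by positivity)).1 ?_
  calc ‖z τ‖ ^ 2 = ‖z τ‖ ^ 2 * Real.exp (-(2 * k) * τ) * Real.exp (k * τ) ^ 2 := by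
        rw [← Real.exp_nat_mul, mul_assoc, ← Real.exp_add]
        simp [mul_assoc]
    _ ≤ ‖z 0‖ ^ 2 * Real.exp (k * τ) ^ 2 := by gcongr
    _ = (‖z 0‖ * Real.exp (k * τ)) ^ 2 := by ring

/-- The quadratic form of an operator of norm at most `δ` is at most `δ‖z‖²`. -/
theorem inner_apply_le_of_opNorm_le {E : Type*} [NormedAddCommGroup E] [InnerProductSpace ℝ E]
    {A : E →L[ℝ] E} {δ : ℝ} (hA : ‖A‖ ≤ δ) (z : E) : ⟪z, A z⟫_ℝ ≤ δ * ‖z‖ ^ 2 := by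
  calc ⟪z, A z⟫_ℝ ≤ ‖z‖ * ‖A z‖ := real_inner_le_norm _ _
    _ ≤ ‖z‖ * (δ * ‖z‖) := by gcongr; exact A.le_of_opNorm_le hA z
    _ = δ * ‖z‖ ^ 2 := by ring

/-- **Continuity of the Dulac map near the stable manifold.** -/
theorem stmt_7 {s u : ℕ} (hs : 1 ≤ s) (hu : 1 ≤ u)
    (Lm : Matrix (Fin s) (Fin s) ℝ) (Lp : Matrix (Fin u) (Fin u) ℝ)
    (hLmsymm : Lm.IsSymm) (hLpsymm : Lp.IsSymm)
    (ft : EuclideanSpace ℝ (Fin s) × EuclideanSpace ℝ (Fin u) → Matrix (Fin s) (Fin s) ℝ)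
    (gt : EuclideanSpace ℝ (Fin s) × EuclideanSpace ℝ (Fin u) → Matrix (Fin u) (Fin u) ℝ)
    (hft : ContDiff ℝ 1 fun p => matCLM (ft p))
    (hgt : ContDiff ℝ 1 fun p => matCLM (gt p))
    (α δ ε : ℝ) (hδ : 0 ≤ δ) (hδα : δ < α) (hε : 0 < ε)
    (hLm : ∀ x : EuclideanSpace ℝ (Fin s), ⟪matCLM Lm x, x⟫_ℝ ≤ -α * ‖x‖ ^ 2)
    (hLp : ∀ y : EuclideanSpace ℝ (Fin u), α * ‖y‖ ^ 2 ≤ ⟪matCLM Lp y, y⟫_ℝ)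
    (hftδ : ∀ x y, max ‖x‖ ‖y‖ ≤ 2 * ε → ‖matCLM (ft (x, y))‖ ≤ δ)
    (hgtδ : ∀ x y, max ‖x‖ ‖y‖ ≤ 2 * ε → ‖matCLM (gt (x, y))‖ ≤ δ) :
    ∀ γ : ℝ, 0 < γ → γ ≤ ε →
      ∃ γ₀ : ℝ, 0 < γ₀ ∧ γ₀ ≤ ε ∧
        ∀ (τ : ℝ), 0 ≤ τ →
        ∀ (x : ℝ → EuclideanSpace ℝ (Fin s)) (y : ℝ → EuclideanSpace ℝ (Fin u)),
          (∀ t ∈ Icc (0 : ℝ) τ,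
            HasDerivWithinAt x (matCLM Lm (x t) + matCLM (ft (x t, y t)) (x t)) (Icc 0 τ) t) →
          (∀ t ∈ Icc (0 : ℝ) τ,
            HasDerivWithinAt y (matCLM Lp (y t) + matCLM (gt (x t, y t)) (y t)) (Icc 0 τ) t) →
          (∀ t ∈ Icc (0 : ℝ) τ, max ‖x t‖ ‖y t‖ ≤ ε) →
          ‖x 0‖ = ε → ‖y 0‖ ≤ γ₀ → ‖y τ‖ = ε →
          ‖x τ‖ ≤ γ := by
  intro γ hγ hγε
  set K : ℝ := ‖matCLM Lp‖ + δ + 1 with hK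
  have hK0 : 0 < K := by positivity
  have hc : 0 < α - δ := sub_pos.2 hδα
  set T : ℝ := Real.log (ε / γ) / (α - δ) with hT
  have hT0 : 0 ≤ T := div_nonneg (Real.log_nonneg ((one_le_div hγ).2 hγε)) hc.le
  refine ⟨ε * Real.exp (-(K * T)), by positivity,
    mul_le_of_le_one_right hε.le (Real.exp_le_one_iff.2 (by nlinarith)), ?_⟩
  intro τ hτ x y hx hy hxy hx0 hy0 hyτ
  have hxy' : ∀ t ∈ Icc (0 : ℝ) τ, max ‖x t‖ ‖y t‖ ≤ 2 * ε := fun t ht => by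
    linarith [hxy t ht]
  have hX : ‖x τ‖ ≤ ‖x 0‖ * Real.exp (-(α - δ) * τ) :=
    norm_le_mul_exp_of_inner_deriv_le_s7 hτ hx fun t ht => by
      have h := inner_apply_le_of_opNorm_le (hftδ _ _ (hxy' t ht)) (x t)
      have h' := hLm (x t)
      rw [real_inner_comm] at h'
      rw [inner_add_right]
      linarith
  have hY : ‖y τ‖ ≤ ‖y 0‖ * Real.exp (K * τ) :=
    norm_le_mul_exp_of_inner_deriv_le_s7 hτ hy fun t ht => by
      have h := inner_apply_le_of_opNorm_le (hgtδ _ _ (hxy' t ht)) (y t)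
      have h' := inner_apply_le_of_opNorm_le (le_refl ‖matCLM Lp‖) (y t)
      rw [inner_add_right, hK]
      nlinarith [sq_nonneg ‖y t‖]
  have hTτ : T ≤ τ := by
    have h : ε * 1 ≤ ε * Real.exp (-(K * T) + K * τ) := by
      rw [Real.exp_add, ← mul_assoc, mul_one]
      calc ε ≤ ‖y 0‖ * Real.exp (K * τ) := hyτ ▸ hY
        _ ≤ _ := by gcongr
    have h' := Real.one_le_exp_iff.1 (le_of_mul_le_mul_left h hε)
    exact le_of_mul_le_mul_left (by linarith) hK0
  calc ‖x τ‖ ≤ ε * Real.exp (-(α - δ) * τ) := hx0 ▸ hX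
    _ ≤ ε * Real.exp (-Real.log (ε / γ)) := by
      gcongr
      have := (div_le_iff₀ hc).1 hTτ
      linarith
    _ = γ := by
      rw [Real.exp_neg, Real.exp_log (by positivity)]
      field_simp
end

section
/- Trajectories through corner points leave the cube immediately: Assume hypothesis H(α,δ,ε) with 0 ≤ δ < α. Then there is no τ > 0 and no C¹ solution (x, y) : [0,τ] → ℝ^s × ℝ^u of the straightened system taking values in C_{2ε} such that ‖y(0)‖ = ε and (x(τ), y(τ)) ∈ C_ε. In other words, if a trajectory starts at a point with ‖y(0)‖ = ε, it never again meets the cube C_ε at any positive time. -/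
open Set
open scoped InnerProductSpace

/-- On an interval where `c * ‖y‖ ^ 2 ≤ ⟪y, y'⟫` with `0 < c`, the norm of a curve that starts away
from the origin ends up strictly larger than it began. -/
theorem norm_lt_norm_of_mul_sq_le_inner_deriv {E : Type*} [NormedAddCommGroup E]
    [InnerProductSpace ℝ E] {y y' : ℝ → E} {a b c : ℝ} (hab : a < b) (hc : 0 < c)
    (hy : ∀ t ∈ Icc a b, HasDerivWithinAt y (y' t) (Icc a b) t)
    (hgrow : ∀ t ∈ Icc a b, c * ‖y t‖ ^ 2 ≤ ⟪y t, y' t⟫_ℝ) (h0 : y a ≠ 0) :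
    ‖y a‖ < ‖y b‖ := by
  have hcont : ContinuousOn (fun t => ‖y t‖ ^ 2) (Icc a b) := fun t ht =>
    ((hy t ht).continuousWithinAt.norm).pow 2
  have hderiv : ∀ t ∈ Ioo a b, HasDerivAt (fun t => ‖y t‖ ^ 2) (2 * ⟪y t, y' t⟫_ℝ) t :=
    fun t ht => ((hy t (Ioo_subset_Icc_self ht)).hasDerivAt (Icc_mem_nhds ht.1 ht.2)).norm_sq
  have hmono : MonotoneOn (fun t => ‖y t‖ ^ 2) (Icc a b) := by
    refine monotoneOn_of_hasDerivWithinAt_nonneg (f' := fun t => 2 * ⟪y t, y' t⟫_ℝ)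
      (convex_Icc a b) hcont ?_ ?_ <;> rw [interior_Icc]
    · exact fun t ht => (hderiv t ht).hasDerivWithinAt
    · intro t ht
      have := hgrow t (Ioo_subset_Icc_self ht)
      have : 0 ≤ c * ‖y t‖ ^ 2 := by positivity
      linarith
  obtain ⟨t, ht, hslope⟩ := exists_hasDerivAt_eq_slope _ _ hab hcont hderiv
  have ht' := Ioo_subset_Icc_self ht
  have hle : ‖y a‖ ^ 2 ≤ ‖y t‖ ^ 2 := hmono (left_mem_Icc.2 hab.le) ht' ht'.1
  have hpos : 0 < ‖y a‖ ^ 2 := by positivity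
  have hslope_pos : 0 < (‖y b‖ ^ 2 - ‖y a‖ ^ 2) / (b - a) := by
    rw [← hslope]
    have := hgrow t ht'
    have : 0 < c * ‖y t‖ ^ 2 := mul_pos hc (hpos.trans_le hle)
    linarith
  rw [div_pos_iff_of_pos_right (sub_pos.2 hab), sub_pos] at hslope_pos
  exact lt_of_pow_lt_pow_left₀ 2 (norm_nonneg _) hslope_pos

/-- A perturbation of norm at most `δ` lowers a quadratic lower bound by at most `δ`. -/
theorem sub_mul_sq_le_inner_add {E : Type*} [NormedAddCommGroup E] [InnerProductSpace ℝ E]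
    {A B : E →L[ℝ] E} {α δ : ℝ} {v : E} (hA : α * ‖v‖ ^ 2 ≤ ⟪A v, v⟫_ℝ) (hB : ‖B‖ ≤ δ) :
    (α - δ) * ‖v‖ ^ 2 ≤ ⟪v, A v + B v⟫_ℝ := by
  have hinner : -⟪v, B v⟫_ℝ ≤ ‖v‖ * ‖B v‖ :=
    (neg_le_abs _).trans (abs_real_inner_le_norm v (B v))
  have hnorm : ‖v‖ * ‖B v‖ ≤ ‖v‖ * (δ * ‖v‖) := by
    gcongr
    exact B.le_of_opNorm_le hB v
  rw [inner_add_right, real_inner_comm]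
  linarith

/-- **Trajectories through corner points leave the cube immediately.** -/
theorem stmt_8 {s u : ℕ} (hs : 1 ≤ s) (hu : 1 ≤ u)
    (Lm : Matrix (Fin s) (Fin s) ℝ) (Lp : Matrix (Fin u) (Fin u) ℝ)
    (hLmsymm : Lm.IsSymm) (hLpsymm : Lp.IsSymm)
    (ft : EuclideanSpace ℝ (Fin s) × EuclideanSpace ℝ (Fin u) → Matrix (Fin s) (Fin s) ℝ)
    (gt : EuclideanSpace ℝ (Fin s) × EuclideanSpace ℝ (Fin u) → Matrix (Fin u) (Fin u) ℝ)
    (hft : ContDiff ℝ 1 fun p => matCLM (ft p))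
    (hgt : ContDiff ℝ 1 fun p => matCLM (gt p))
    (α δ ε : ℝ) (hδ : 0 ≤ δ) (hδα : δ < α) (hε : 0 < ε)
    (hLm : ∀ x : EuclideanSpace ℝ (Fin s), ⟪matCLM Lm x, x⟫_ℝ ≤ -α * ‖x‖ ^ 2)
    (hLp : ∀ y : EuclideanSpace ℝ (Fin u), α * ‖y‖ ^ 2 ≤ ⟪matCLM Lp y, y⟫_ℝ)
    (hftδ : ∀ x y, max ‖x‖ ‖y‖ ≤ 2 * ε → ‖matCLM (ft (x, y))‖ ≤ δ)
    (hgtδ : ∀ x y, max ‖x‖ ‖y‖ ≤ 2 * ε → ‖matCLM (gt (x, y))‖ ≤ δ) :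
    ¬ ∃ (τ : ℝ) (_ : 0 < τ)
        (x : ℝ → EuclideanSpace ℝ (Fin s)) (y : ℝ → EuclideanSpace ℝ (Fin u)),
        (∀ t ∈ Icc (0 : ℝ) τ,
          HasDerivWithinAt x (matCLM Lm (x t) + matCLM (ft (x t, y t)) (x t)) (Icc 0 τ) t) ∧
        (∀ t ∈ Icc (0 : ℝ) τ,
          HasDerivWithinAt y (matCLM Lp (y t) + matCLM (gt (x t, y t)) (y t)) (Icc 0 τ) t) ∧
        (∀ t ∈ Icc (0 : ℝ) τ, max ‖x t‖ ‖y t‖ ≤ 2 * ε) ∧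
        ‖y 0‖ = ε ∧ max ‖x τ‖ ‖y τ‖ ≤ ε := by
  rintro ⟨τ, hτ, x, y, -, hy, hbound, hy0, hend⟩
  have hlt := norm_lt_norm_of_mul_sq_le_inner_deriv hτ (sub_pos.2 hδα) hy
    (fun t ht => sub_mul_sq_le_inner_add (hLp (y t)) (hgtδ _ _ (hbound t ht)))
    (norm_pos_iff.1 (hy0 ▸ hε))
  exact (hlt.trans_le ((le_max_right _ _).trans hend)).ne hy0
end

section
/- λ-lemma-type accumulation on the unstable manifold: Assume hypothesis H(α,δ,ε) with 0 ≤ δ < α. Let q ∈ ℝ^s with ‖q‖ < ε (so (q,0) ∈ C_ε lies on the stable manifold {y = 0}) and let r ∈ ℝ^u with ‖r‖ < ε (so (0,r) ∈ C_ε lies on the unstable manifold {x = 0}). Then for every ε' > 0 there exist sequences y'_n ∈ ℝ^u with ‖y'_n‖ ≤ ε' and y'_n → 0, points (x_n, y_n) ∈ C_ε with (x_n, y_n) → (0, r), times t_n ≥ 0, and C¹ solutions γ_n : [0, t_n] → C_ε of the straightened system with γ_n(0) = (q, y'_n) and γ_n(t_n) = (x_n, y_n). -/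
open Set
open scoped InnerProductSpace

/-- A self-map of a complete metric space has a fixed point as soon as it contracts a relation
`R D x y` (`x` and `y` are within weighted distance `D`) equivalent to the metric. -/
theorem exists_fixedPoint_of_weighted_contraction {Z : Type*} [MetricSpace Z] [CompleteSpace Z]
    [Nonempty Z] (Φ : Z → Z) (R : ℝ → Z → Z → Prop) {κ C : ℝ} (hκ : 0 ≤ κ) (hκ1 : κ < 1)
    (hC : 0 ≤ C) (hR : ∀ x y, R (C * dist x y) x y)
    (hdist : ∀ D x y, 0 ≤ D → R D x y → dist x y ≤ C * D)
    (hΦ : ∀ D x y, 0 ≤ D → R D x y → R (κ * D) (Φ x) (Φ y)) : ∃ x, Φ x = x := by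
  have hiter : ∀ (n : ℕ) x y, R (κ ^ n * (C * dist x y)) (Φ^[n] x) (Φ^[n] y) := by
    intro n x y
    induction n with
    | zero => simpa using hR x y
    | succ n ih =>
      rw [Function.iterate_succ_apply', Function.iterate_succ_apply', pow_succ', mul_assoc]
      exact hΦ _ _ _ (by positivity) ih
  obtain ⟨n, hn⟩ : ∃ n : ℕ, C * κ ^ n * C < 1 := by
    have h := ((tendsto_pow_atTop_nhds_zero_of_lt_one hκ hκ1).const_mul C).mul_const C
    simp only [mul_zero, zero_mul] at h
    exact (h.eventually (gt_mem_nhds one_pos)).exists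
  have hcontr : ContractingWith (Real.toNNReal (C * κ ^ n * C)) Φ^[n] := by
    refine ⟨by simpa using hn, LipschitzWith.of_dist_le_mul fun x y => ?_⟩
    rw [Real.coe_toNNReal _ (by positivity)]
    refine (hdist _ _ _ (by positivity) (hiter n x y)).trans (le_of_eq (by ring))
  exact ⟨_, hcontr.isFixedPt_fixedPoint_iterate⟩

/-- The solution of `U' = A U + h`, `U 0 = q`, given by the variation of constants formula. -/
noncomputable def duhamel {E : Type*} [NormedAddCommGroup E] [InnerProductSpace ℝ E]
    (A : E →L[ℝ] E) (q : E) (h : ℝ → E) (t : ℝ) : E :=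
  NormedSpace.exp (t • A) (q + ∫ s in (0 : ℝ)..t, NormedSpace.exp ((-s) • A) (h s))

section Hyperbolic

variable {E F : Type*} [NormedAddCommGroup E] [InnerProductSpace ℝ E]
  [NormedAddCommGroup F]

theorem duhamel_zero (A : E →L[ℝ] E) (q : E) (h : ℝ → E) : duhamel A q h 0 = q := by
  simp [duhamel]

theorem hasDerivAt_duhamel [CompleteSpace E] (A : E →L[ℝ] E) (q : E) {h : ℝ → E}
    (hh : Continuous h) (t : ℝ) :
    HasDerivAt (duhamel A q h) (A (duhamel A q h t) + h t) t := by
  let _ : NormedAlgebra ℚ (E →L[ℝ] E) := NormedAlgebra.restrictScalars ℚ ℝ (E →L[ℝ] E)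
  have hexp : Continuous fun s : ℝ => NormedSpace.exp ((-s) • A) :=
    NormedSpace.exp_continuous.comp (by fun_prop)
  have hcont : Continuous fun s : ℝ => NormedSpace.exp ((-s) • A) (h s) := hexp.clm_apply hh
  have hint : HasDerivAt (fun u => q + ∫ s in (0 : ℝ)..u, NormedSpace.exp ((-s) • A) (h s))
      (NormedSpace.exp ((-t) • A) (h t)) t :=
    (intervalIntegral.integral_hasDerivAt_right (hcont.intervalIntegrable _ _)
      (hcont.stronglyMeasurableAtFilter _ _) hcont.continuousAt).const_add q
  have hd := (hasDerivAt_exp_smul_const' (𝕂 := ℝ) A t).clm_apply hint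
  have hinv : NormedSpace.exp (t • A) * NormedSpace.exp ((-t) • A) = 1 := by
    rw [← NormedSpace.exp_add_of_commute]
    · simp
    · exact ((Commute.refl A).smul_left t).smul_right (-t)
  have happ : NormedSpace.exp (t • A) (NormedSpace.exp ((-t) • A) (h t)) = h t :=
    congrArg (fun B : E →L[ℝ] E => B (h t)) hinv
  rw [happ] at hd
  exact hd

/-- Comparison principle: a solution of `U' = A U + h` with `A ≤ -α` is dominated by any
supersolution `β` of `β' = -α β + ‖h‖`. -/
theorem norm_le_of_dissipative_s9 {A : E →L[ℝ] E} {α T : ℝ} (hα : 0 < α)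
    (hA : ∀ x, ⟪A x, x⟫_ℝ ≤ -α * ‖x‖ ^ 2) {U h : ℝ → E} {β β' : ℝ → ℝ}
    (hU : ∀ t, HasDerivAt U (A (U t) + h t) t) (hβ : ∀ t, HasDerivAt β (β' t) t)
    (hβ0 : ∀ t ∈ Icc 0 T, 0 ≤ β t) (h0 : ‖U 0‖ ≤ β 0)
    (hh : ∀ t ∈ Icc 0 T, ‖h t‖ ≤ β' t + α * β t) :
    ∀ t ∈ Icc 0 T, ‖U t‖ ≤ β t := by
  intro t ht
  refine le_of_forall_pos_le_add fun η hη => ?_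
  have hUc : Continuous U := continuous_iff_continuousAt.2 fun t => (hU t).continuousAt
  have hsq : ‖U t‖ ^ 2 ≤ (β t + η) ^ 2 := by
    refine image_le_of_deriv_right_lt_deriv_boundary (a := 0) (b := T)
      (f := fun t => ‖U t‖ ^ 2) (f' := fun t => 2 * ⟪U t, A (U t) + h t⟫_ℝ)
      (B := fun t => (β t + η) ^ 2) (B' := fun t => 2 * (β t + η) * β' t)
      (by fun_prop) (fun x _ => (hU x).norm_sq.hasDerivWithinAt) ?_ ?_ ?_ ht
    · have := norm_nonneg (U 0)
      exact pow_le_pow_left₀ this (by linarith) 2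
    · intro x
      exact (((hβ x).add_const η).fun_pow 2).congr_deriv (by simp)
    · intro x hx heq
      have hx' := Ico_subset_Icc_self hx
      have hb := hβ0 x hx'
      have heq' : ‖U x‖ = β x + η :=
        (sq_eq_sq₀ (norm_nonneg _) (by linarith)).1 heq
      have h1 := hA (U x)
      have h2 := real_inner_le_norm (U x) (h x)
      have h3 := hh x hx'
      rw [inner_add_right, real_inner_comm]
      rw [heq'] at h1 h2
      have hpos : 0 < β x + η := by linarith
      have h4 : (β x + η) * ‖h x‖ ≤ (β x + η) * (β' x + α * β x) := by gcongr
      have h5 : 0 < (β x + η) * (α * η) := by positivity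
      nlinarith
  exact (sq_le_sq₀ (norm_nonneg _) (by linarith [hβ0 t ht])).1 hsq

/-- The nonlinear forcing along a curve `X` run forwards and a curve `Y` run backwards on
`[0, T]`. -/
noncomputable def forcing {T : ℝ} (hT : 0 ≤ T) (f : C(E × F, E →L[ℝ] E))
    (X : C(Icc 0 T, E)) (Y : C(Icc 0 T, F)) (t : ℝ) : E :=
  f (IccExtend hT X t, IccExtend hT Y (T - t)) (IccExtend hT X t)

theorem continuous_forcing {T : ℝ} (hT : 0 ≤ T) (f : C(E × F, E →L[ℝ] E))
    (X : C(Icc 0 T, E)) (Y : C(Icc 0 T, F)) : Continuous (forcing hT f X Y) := by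
  have hX : Continuous (IccExtend hT X) := X.continuous.Icc_extend'
  have hY : Continuous (IccExtend hT Y) := Y.continuous.Icc_extend'
  unfold forcing
  fun_prop

/-- One component of the fixed point map of the two-point boundary value problem. -/
noncomputable def duhamelMap [CompleteSpace E] {T : ℝ} (hT : 0 ≤ T) (A : E →L[ℝ] E) (q : E)
    (f : C(E × F, E →L[ℝ] E)) (X : C(Icc 0 T, E)) (Y : C(Icc 0 T, F)) : C(Icc 0 T, E) where
  toFun t := duhamel A q (forcing hT f X Y) t
  continuous_toFun :=
    (continuous_iff_continuousAt.2 fun t =>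
      (hasDerivAt_duhamel A q (continuous_forcing hT f X Y) t).continuousAt).comp
      continuous_subtype_val

theorem forcing_eq {T : ℝ} (hT : 0 ≤ T) (f : C(E × F, E →L[ℝ] E)) (X : C(Icc 0 T, E))
    (Y : C(Icc 0 T, F)) {t : ℝ} (ht : t ∈ Icc 0 T) (ht' : T - t ∈ Icc 0 T) :
    forcing hT f X Y t = f (X ⟨t, ht⟩, Y ⟨T - t, ht'⟩) (X ⟨t, ht⟩) := by
  simp only [forcing, IccExtend_of_mem hT _ ht, IccExtend_of_mem hT _ ht']

theorem sub_mem_Icc_zero {T t : ℝ} (ht : t ∈ Icc 0 T) : T - t ∈ Icc 0 T :=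
  ⟨by linarith [ht.2], by linarith [ht.1]⟩

theorem norm_duhamelMap_le [CompleteSpace E] {T α δ ε : ℝ} (hT : 0 ≤ T) {A : E →L[ℝ] E} {q : E}
    {f : C(E × F, E →L[ℝ] E)} (hδ : 0 ≤ δ) (hδα : δ < α) (hε : 0 ≤ ε)
    (hA : ∀ x, ⟪A x, x⟫_ℝ ≤ -α * ‖x‖ ^ 2)
    (hf : ∀ x y, ‖x‖ ≤ ε → ‖y‖ ≤ ε → ‖f (x, y)‖ ≤ δ) (hq : ‖q‖ ≤ ε)
    {X : C(Icc 0 T, E)} {Y : C(Icc 0 T, F)}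
    (hX : ∀ t : Icc 0 T, ‖X t‖ ≤ ε * Real.exp (-(α - δ) * t))
    (hY : ∀ t, ‖Y t‖ ≤ ε) (t : Icc 0 T) :
    ‖duhamelMap hT A q f X Y t‖ ≤ ε * Real.exp (-(α - δ) * t) := by
  have hle : ∀ t ∈ Icc 0 T, ε * Real.exp (-(α - δ) * t) ≤ ε := fun t ht =>
    mul_le_of_le_one_right hε (Real.exp_le_one_iff.2 (by nlinarith [ht.1]))
  refine norm_le_of_dissipative_s9 (by linarith) hA
    (hasDerivAt_duhamel A q (continuous_forcing hT f X Y))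
    (β := fun t => ε * Real.exp (-(α - δ) * t))
    (β' := fun t => ε * (Real.exp (-(α - δ) * t) * (-(α - δ)))) (fun t => ?_)
    (fun t _ => by positivity) (by simpa [duhamel_zero] using hq) (fun t ht => ?_) t t.2
  · simpa using (((hasDerivAt_id t).const_mul (-(α - δ))).exp).const_mul ε
  · rw [forcing_eq hT f X Y ht (sub_mem_Icc_zero ht)]
    have h1 := hX ⟨t, ht⟩
    refine (ContinuousLinearMap.le_opNorm _ _).trans ?_
    calc _ ≤ δ * (ε * Real.exp (-(α - δ) * t)) :=
          mul_le_mul (hf _ _ (h1.trans (hle t ht)) (hY _)) h1 (norm_nonneg _) hδ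
      _ = _ := by ring

theorem norm_duhamelMap_sub_le [CompleteSpace E] {T α δ ε K κ D : ℝ} (hT : 0 ≤ T)
    {A : E →L[ℝ] E} {q : E} {f : C(E × F, E →L[ℝ] E)} (hδ : 0 ≤ δ) (hδα : δ < α) (hε : 0 ≤ ε)
    (hK : 0 ≤ K) (hκ : 0 ≤ κ) (hD : 0 ≤ D)
    (hA : ∀ x, ⟪A x, x⟫_ℝ ≤ -α * ‖x‖ ^ 2)
    (hf : ∀ x y, ‖x‖ ≤ ε → ‖y‖ ≤ ε → ‖f (x, y)‖ ≤ δ)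
    (hfK : ∀ x y x' y', ‖x‖ ≤ ε → ‖y‖ ≤ ε → ‖x'‖ ≤ ε → ‖y'‖ ≤ ε →
      ‖f (x, y) - f (x', y')‖ ≤ K * (‖x - x'‖ + ‖y - y'‖))
    {w w' : ℝ → ℝ} (hw : ∀ t, HasDerivAt w (w' t) t) (hw0 : ∀ t, 0 < w t)
    (hwT : ∀ t ∈ Icc 0 T, δ * w t + K * ε * Real.exp (-(α - δ) * t) * (w t + w (T - t)) ≤
      κ * (w' t + α * w t))
    {X X' : C(Icc 0 T, E)} {Y Y' : C(Icc 0 T, F)}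
    (hX : ∀ t, ‖X t‖ ≤ ε) (hX' : ∀ t : Icc 0 T, ‖X' t‖ ≤ ε * Real.exp (-(α - δ) * t))
    (hY : ∀ t, ‖Y t‖ ≤ ε) (hY' : ∀ t, ‖Y' t‖ ≤ ε)
    (hXX' : ∀ t : Icc 0 T, ‖X t - X' t‖ ≤ D * w t)
    (hYY' : ∀ t : Icc 0 T, ‖Y t - Y' t‖ ≤ D * w t) (t : Icc 0 T) :
    ‖duhamelMap hT A q f X Y t - duhamelMap hT A q f X' Y' t‖ ≤ κ * D * w t := by
  have hle : ∀ t ∈ Icc 0 T, ε * Real.exp (-(α - δ) * t) ≤ ε := fun t ht =>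
    mul_le_of_le_one_right hε (Real.exp_le_one_iff.2 (by nlinarith [ht.1]))
  refine norm_le_of_dissipative_s9 (by linarith) hA
    (U := fun t => duhamel A q (forcing hT f X Y) t - duhamel A q (forcing hT f X' Y') t)
    (h := fun t => forcing hT f X Y t - forcing hT f X' Y' t)
    (β := fun t => κ * D * w t) (β' := fun t => κ * D * w' t) (fun t => ?_)
    (fun t => (hw t).const_mul _) (fun t _ => by have := hw0 t; positivity)
    (by have := hw0 0; simp only [duhamel_zero, sub_self, norm_zero]; positivity)
    (fun t ht => ?_) t t.2
  · convert (hasDerivAt_duhamel A q (continuous_forcing hT f X Y) t).fun_sub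
      (hasDerivAt_duhamel A q (continuous_forcing hT f X' Y') t) using 1
    rw [map_sub]
    abel
  · have ht' := sub_mem_Icc_zero ht
    rw [forcing_eq hT f X Y ht ht', forcing_eq hT f X' Y' ht ht']
    set x := X ⟨t, ht⟩
    set x' := X' ⟨t, ht⟩
    set y := Y ⟨T - t, ht'⟩
    set y' := Y' ⟨T - t, ht'⟩
    have hx' : ‖x'‖ ≤ ε * Real.exp (-(α - δ) * t) := hX' ⟨t, ht⟩
    have hdx : ‖x - x'‖ ≤ D * w t := hXX' ⟨t, ht⟩
    have hdy : ‖y - y'‖ ≤ D * w (T - t) := hYY' ⟨T - t, ht'⟩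
    have hsplit : f (x, y) x - f (x', y') x' =
        f (x, y) (x - x') + (f (x, y) - f (x', y')) x' := by
      simp only [map_sub, sub_apply]; abel
    have h1 : ‖f (x, y) (x - x')‖ ≤ δ * (D * w t) :=
      (ContinuousLinearMap.le_opNorm _ _).trans
        (mul_le_mul (hf _ _ (hX _) (hY _)) hdx (norm_nonneg _) hδ)
    have h2 : ‖(f (x, y) - f (x', y')) x'‖ ≤
        K * (D * w t + D * w (T - t)) * (ε * Real.exp (-(α - δ) * t)) := by
      refine (ContinuousLinearMap.le_opNorm _ _).trans (mul_le_mul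
        ((hfK _ _ _ _ (hX _) (hY _) (hx'.trans (hle t ht)) (hY' _)).trans ?_) hx'
        (norm_nonneg _) ?_)
      · gcongr
      · have := hw0 t
        have := hw0 (T - t)
        positivity
    rw [hsplit]
    refine (norm_add_le _ _).trans ((add_le_add h1 h2).trans ?_)
    have := mul_le_mul_of_nonneg_left (hwT t ht) hD
    linarith

/-- An exponentially decaying weight for which the boundary value map on `[0, T]` is a contraction
with factor `κ`, uniformly in large `T`. -/
theorem exists_weight {α δ ε K : ℝ} (hδ : 0 ≤ δ) (hδα : δ < α) (hε : 0 ≤ ε) (hK : 0 ≤ K) :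
    ∃ (κ T₀ : ℝ) (w w' : ℝ → ℝ), 0 ≤ κ ∧ κ < 1 ∧ (∀ t, HasDerivAt w (w' t) t) ∧ (∀ t, 0 < w t) ∧
      ∀ T, T₀ ≤ T → ∀ t ∈ Icc 0 T,
        δ * w t + K * ε * Real.exp (-(α - δ) * t) * (w t + w (T - t)) ≤
          κ * (w' t + α * w t) := by
  obtain ⟨ν, hν⟩ : ∃ ν, ν = (α - δ) / 2 := ⟨_, rfl⟩
  obtain ⟨κ, hκ⟩ : ∃ κ, κ = (α + 3 * δ) / (2 * (α + δ)) := ⟨_, rfl⟩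
  have hν0 : 0 < ν := by linarith
  have hαδ : 0 < α + δ := by linarith
  have hκ0 : 0 < κ := by rw [hκ]; exact div_pos (by linarith) (by linarith)
  have hκ1 : κ < 1 := by rw [hκ, div_lt_one (by linarith)]; linarith
  have hκα : κ * (α - ν) = δ + ν / 2 := by
    rw [hκ, hν]; field_simp; ring
  obtain ⟨M, hM⟩ : ∃ M, M = K * ε / (κ * ν) := ⟨_, rfl⟩
  have hM0 : 0 ≤ M := by rw [hM]; positivity
  have hκM : κ * M * ν = K * ε := by rw [hM]; field_simp
  have hlim : Filter.Tendsto (fun T => K * ε * Real.exp M * Real.exp (-(ν * T)))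
      Filter.atTop (nhds 0) := by
    have h1 := Real.tendsto_exp_neg_atTop_nhds_zero.comp
      (Filter.tendsto_id.const_mul_atTop hν0)
    simpa using h1.const_mul (K * ε * Real.exp M)
  obtain ⟨T₀, hT₀⟩ := Filter.eventually_atTop.1
    (hlim.eventually (ge_mem_nhds (show 0 < ν / 2 by linarith)))
  refine ⟨κ, T₀, fun t => Real.exp (-ν * t + M * (1 - Real.exp (-ν * t))),
    fun t => Real.exp (-ν * t + M * (1 - Real.exp (-ν * t))) *
      (-ν + M * ν * Real.exp (-ν * t)), hκ0.le, hκ1, fun t => ?_, fun t => Real.exp_pos _,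
    fun T hT t ht => ?_⟩
  · have hlin : HasDerivAt (fun t => -ν * t) (-ν) t := by
      simpa using (hasDerivAt_id t).const_mul (-ν)
    convert (hlin.fun_add ((hlin.exp.const_sub 1).const_mul M)).exp using 1
    ring
  · have hlow : Real.exp (-ν * t) ≤ Real.exp (-ν * t + M * (1 - Real.exp (-ν * t))) := by
      have : Real.exp (-ν * t) ≤ 1 := Real.exp_le_one_iff.2 (by nlinarith [ht.1])
      gcongr
      nlinarith
    have hup : Real.exp (-ν * (T - t) + M * (1 - Real.exp (-ν * (T - t)))) ≤
        Real.exp M * Real.exp (-ν * (T - t)) := by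
      rw [← Real.exp_add]
      refine Real.exp_le_exp.2 ?_
      have := mul_nonneg hM0 (Real.exp_pos (-ν * (T - t))).le
      linarith
    have hexp : Real.exp (-(α - δ) * t) = Real.exp (-ν * t) * Real.exp (-ν * t) := by
      rw [← Real.exp_add, hν]; ring_nf
    have hE1 : Real.exp (-ν * t) ≤ 1 := Real.exp_le_one_iff.2 (by nlinarith [ht.1])
    have hE0 := Real.exp_pos (-ν * t)
    set W := Real.exp (-ν * t + M * (1 - Real.exp (-ν * t)))
    set W' := Real.exp (-ν * (T - t) + M * (1 - Real.exp (-ν * (T - t))))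
    have hW : 0 < W := Real.exp_pos _
    have hKε : 0 ≤ K * ε := by positivity
    have h1 : K * ε * (Real.exp (-ν * t) * Real.exp (-ν * t)) * W ≤
        K * ε * Real.exp (-ν * t) * W := by
      gcongr
      nlinarith
    have h2 : K * ε * (Real.exp (-ν * t) * Real.exp (-ν * t)) * W' ≤ ν / 2 * W := by
      calc _ ≤ K * ε * (Real.exp (-ν * t) * Real.exp (-ν * t)) *
            (Real.exp M * Real.exp (-ν * (T - t))) := by gcongr
        _ = K * ε * Real.exp M * (Real.exp (-ν * t) * Real.exp (-ν * (T - t))) *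
            Real.exp (-ν * t) := by ring
        _ = K * ε * Real.exp M * Real.exp (-(ν * T)) * Real.exp (-ν * t) := by
            rw [← Real.exp_add]; ring_nf
        _ ≤ ν / 2 * W := mul_le_mul (hT₀ T hT) hlow hE0.le (by linarith)
    rw [hexp]
    calc _ ≤ δ * W + (K * ε * Real.exp (-ν * t) * W + ν / 2 * W) := by linarith
      _ = κ * (α - ν) * W + κ * M * ν * Real.exp (-ν * t) * W := by rw [hκα, hκM]; ring
      _ = _ := by ring

variable [InnerProductSpace ℝ F]

/-- Solvability of the two-point boundary value problem with `x 0 = q` and `y T = r`. The second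
curve is parametrized backwards, so that both components are dissipative. -/
theorem exists_boundaryValue_solution [CompleteSpace E] [CompleteSpace F]
    {T α δ ε K κ : ℝ} (hT : 0 ≤ T)
    {A : E →L[ℝ] E} {B : F →L[ℝ] F} {q : E} {r : F}
    {f : C(E × F, E →L[ℝ] E)} {g : C(F × E, F →L[ℝ] F)}
    (hδ : 0 ≤ δ) (hδα : δ < α) (hε : 0 ≤ ε) (hK : 0 ≤ K) (hκ : 0 ≤ κ) (hκ1 : κ < 1)
    (hA : ∀ x, ⟪A x, x⟫_ℝ ≤ -α * ‖x‖ ^ 2) (hB : ∀ y, ⟪B y, y⟫_ℝ ≤ -α * ‖y‖ ^ 2)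
    (hf : ∀ x y, ‖x‖ ≤ ε → ‖y‖ ≤ ε → ‖f (x, y)‖ ≤ δ)
    (hg : ∀ y x, ‖y‖ ≤ ε → ‖x‖ ≤ ε → ‖g (y, x)‖ ≤ δ)
    (hfK : ∀ x y x' y', ‖x‖ ≤ ε → ‖y‖ ≤ ε → ‖x'‖ ≤ ε → ‖y'‖ ≤ ε →
      ‖f (x, y) - f (x', y')‖ ≤ K * (‖x - x'‖ + ‖y - y'‖))
    (hgK : ∀ y x y' x', ‖y‖ ≤ ε → ‖x‖ ≤ ε → ‖y'‖ ≤ ε → ‖x'‖ ≤ ε →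
      ‖g (y, x) - g (y', x')‖ ≤ K * (‖y - y'‖ + ‖x - x'‖))
    {w w' : ℝ → ℝ} (hw : ∀ t, HasDerivAt w (w' t) t) (hw0 : ∀ t, 0 < w t)
    (hwT : ∀ t ∈ Icc 0 T, δ * w t + K * ε * Real.exp (-(α - δ) * t) * (w t + w (T - t)) ≤
      κ * (w' t + α * w t))
    (hq : ‖q‖ ≤ ε) (hr : ‖r‖ ≤ ε) :
    ∃ (U : ℝ → E) (V : ℝ → F), U 0 = q ∧ V 0 = r ∧
      (∀ t ∈ Icc 0 T, HasDerivAt U (A (U t) + f (U t, V (T - t)) (U t)) t) ∧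
      (∀ t ∈ Icc 0 T, HasDerivAt V (B (V t) + g (V t, U (T - t)) (V t)) t) ∧
      (∀ t ∈ Icc 0 T, ‖U t‖ ≤ ε * Real.exp (-(α - δ) * t)) ∧
      (∀ t ∈ Icc 0 T, ‖V t‖ ≤ ε * Real.exp (-(α - δ) * t)) := by
  have hle : ∀ t : Icc 0 T, ε * Real.exp (-(α - δ) * t) ≤ ε := fun t =>
    mul_le_of_le_one_right hε (Real.exp_le_one_iff.2 (by nlinarith [t.2.1]))
  let S : Set (C(Icc 0 T, E) × C(Icc 0 T, F)) :=
    {Z | (∀ t : Icc 0 T, ‖Z.1 t‖ ≤ ε * Real.exp (-(α - δ) * t)) ∧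
      ∀ t : Icc 0 T, ‖Z.2 t‖ ≤ ε * Real.exp (-(α - δ) * t)}
  have hSc : IsClosed S := by
    have h1 : ∀ t : Icc 0 T, Continuous fun Z : C(Icc 0 T, E) × C(Icc 0 T, F) => ‖Z.1 t‖ :=
      fun t => ((continuous_eval_const t).comp continuous_fst).norm
    have h2 : ∀ t : Icc 0 T, Continuous fun Z : C(Icc 0 T, E) × C(Icc 0 T, F) => ‖Z.2 t‖ :=
      fun t => ((continuous_eval_const t).comp continuous_snd).norm
    simp only [S, Set.ofPred_and, Set.ofPred_forall]
    exact (isClosed_iInter fun t => isClosed_le (h1 t) continuous_const).inter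
      (isClosed_iInter fun t => isClosed_le (h2 t) continuous_const)
  have : CompleteSpace S := hSc.completeSpace_coe
  have : Nonempty S := ⟨⟨0, fun t => by simp; positivity, fun t => by simp; positivity⟩⟩
  let Φ : S → S := fun Z => ⟨(duhamelMap hT A q f Z.1.1 Z.1.2, duhamelMap hT B r g Z.1.2 Z.1.1),
    norm_duhamelMap_le hT hδ hδα hε hA hf hq Z.2.1 fun t => (Z.2.2 t).trans (hle t),
    norm_duhamelMap_le hT hδ hδα hε hB hg hr Z.2.2 fun t => (Z.2.1 t).trans (hle t)⟩
  have hwc : Continuous w := continuous_iff_continuousAt.2 fun t => (hw t).continuousAt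
  obtain ⟨C, hCw, hCw'⟩ : ∃ C, (∀ t ∈ Icc 0 T, w t ≤ C) ∧ ∀ t ∈ Icc 0 T, 1 ≤ C * w t := by
    obtain ⟨C₁, hC₁⟩ := isCompact_Icc.bddAbove_image (hwc.continuousOn (s := Icc 0 T))
    obtain ⟨C₂, hC₂⟩ := isCompact_Icc.bddAbove_image
      ((hwc.inv₀ fun t => (hw0 t).ne').continuousOn (s := Icc 0 T))
    refine ⟨max C₁ C₂, fun t ht => (hC₁ (mem_image_of_mem _ ht)).trans (le_max_left _ _),
      fun t ht => ?_⟩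
    rw [← div_le_iff₀ (hw0 t), one_div]
    exact (hC₂ (mem_image_of_mem (fun t => (w t)⁻¹) ht)).trans (le_max_right _ _)
  have hC0 : 0 ≤ C := (hw0 0).le.trans (hCw 0 ⟨le_rfl, hT⟩)
  have hfix : ∃ Z, Φ Z = Z := by
    refine exists_fixedPoint_of_weighted_contraction Φ
      (fun D Z Z' => (∀ t : Icc 0 T, ‖Z.1.1 t - Z'.1.1 t‖ ≤ D * w t) ∧
        ∀ t : Icc 0 T, ‖Z.1.2 t - Z'.1.2 t‖ ≤ D * w t) hκ hκ1 hC0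
      (fun Z Z' => ⟨fun t => ?_, fun t => ?_⟩) (fun D Z Z' hD h => ?_)
      (fun D Z Z' hD h => ⟨fun t => ?_, fun t => ?_⟩)
    · rw [← dist_eq_norm]
      calc dist (Z.1.1 t) (Z'.1.1 t) ≤ dist Z Z' :=
            (ContinuousMap.dist_apply_le_dist t).trans (le_max_left _ _)
        _ ≤ dist Z Z' * (C * w t) := le_mul_of_one_le_right dist_nonneg (hCw' t t.2)
        _ = _ := by ring
    · rw [← dist_eq_norm]
      calc dist (Z.1.2 t) (Z'.1.2 t) ≤ dist Z Z' :=
            (ContinuousMap.dist_apply_le_dist t).trans (le_max_right _ _)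
        _ ≤ dist Z Z' * (C * w t) := le_mul_of_one_le_right dist_nonneg (hCw' t t.2)
        _ = _ := by ring
    · have hDw : ∀ t : Icc 0 T, D * w t ≤ C * D := fun t => by
        rw [mul_comm C]; exact mul_le_mul_of_nonneg_left (hCw t t.2) hD
      have hCD : 0 ≤ C * D := by positivity
      exact max_le
        ((ContinuousMap.dist_le hCD).2 fun t => (dist_eq_norm _ _).trans_le ((h.1 t).trans (hDw t)))
        ((ContinuousMap.dist_le hCD).2 fun t => (dist_eq_norm _ _).trans_le ((h.2 t).trans (hDw t)))
    · exact norm_duhamelMap_sub_le hT hδ hδα hε hK hκ hD hA hf hfK hw hw0 hwT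
        (fun t => (Z.2.1 t).trans (hle t)) Z'.2.1 (fun t => (Z.2.2 t).trans (hle t))
        (fun t => (Z'.2.2 t).trans (hle t)) h.1 h.2 t
    · exact norm_duhamelMap_sub_le hT hδ hδα hε hK hκ hD hB hg hgK hw hw0 hwT
        (fun t => (Z.2.2 t).trans (hle t)) Z'.2.2 (fun t => (Z.2.1 t).trans (hle t))
        (fun t => (Z'.2.1 t).trans (hle t)) h.2 h.1 t
  obtain ⟨Z, hZ⟩ := hfix
  have hZ' := congrArg Subtype.val hZ
  have hU : ∀ t (ht : t ∈ Icc 0 T), duhamel A q (forcing hT f Z.1.1 Z.1.2) t = Z.1.1 ⟨t, ht⟩ :=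
    fun t ht => DFunLike.congr_fun (congrArg Prod.fst hZ') ⟨t, ht⟩
  have hV : ∀ t (ht : t ∈ Icc 0 T), duhamel B r (forcing hT g Z.1.2 Z.1.1) t = Z.1.2 ⟨t, ht⟩ :=
    fun t ht => DFunLike.congr_fun (congrArg Prod.snd hZ') ⟨t, ht⟩
  refine ⟨duhamel A q (forcing hT f Z.1.1 Z.1.2), duhamel B r (forcing hT g Z.1.2 Z.1.1),
    duhamel_zero _ _ _, duhamel_zero _ _ _, fun t ht => ?_, fun t ht => ?_, fun t ht => ?_,
    fun t ht => ?_⟩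
  · have h := hasDerivAt_duhamel A q (continuous_forcing hT f Z.1.1 Z.1.2) t
    have ht' := sub_mem_Icc_zero ht
    rwa [forcing_eq hT f _ _ ht ht', ← hU t ht, ← hV _ ht'] at h
  · have h := hasDerivAt_duhamel B r (continuous_forcing hT g Z.1.2 Z.1.1) t
    have ht' := sub_mem_Icc_zero ht
    rwa [forcing_eq hT g _ _ ht ht', ← hV t ht, ← hU _ ht'] at h
  · rw [hU t ht]
    exact Z.2.1 ⟨t, ht⟩
  · rw [hV t ht]
    exact Z.2.2 ⟨t, ht⟩

end Hyperbolic

theorem exists_norm_sub_le_of_contDiff {E F G : Type*} [NormedAddCommGroup E]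
    [InnerProductSpace ℝ E] [FiniteDimensional ℝ E] [NormedAddCommGroup F]
    [InnerProductSpace ℝ F] [FiniteDimensional ℝ F] [NormedAddCommGroup G] [NormedSpace ℝ G]
    {f : E × F → G} (hf : ContDiff ℝ 1 f) (ε : ℝ) :
    ∃ K : ℝ, 0 ≤ K ∧ ∀ x y x' y', ‖x‖ ≤ ε → ‖y‖ ≤ ε → ‖x'‖ ≤ ε → ‖y'‖ ≤ ε →
      ‖f (x, y) - f (x', y')‖ ≤ K * (‖x - x'‖ + ‖y - y'‖) := by
  have := FiniteDimensional.proper ℝ E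
  have := FiniteDimensional.proper ℝ F
  obtain ⟨K, hK⟩ := (hf.locallyLipschitz.locallyLipschitzOn
    (s := Metric.closedBall 0 ε)).exists_lipschitzOnWith_of_compact
      (isCompact_closedBall (0 : E × F) ε)
  refine ⟨K, K.2, fun x y x' y' hx hy hx' hy' => ?_⟩
  have h := hK.norm_sub_le (x := (x, y)) (y := (x', y'))
    (by simpa [Prod.norm_def] using ⟨hx, hy⟩) (by simpa [Prod.norm_def] using ⟨hx', hy'⟩)
  refine h.trans (mul_le_mul_of_nonneg_left ?_ K.2)
  exact max_le (le_add_of_nonneg_right (norm_nonneg _)) (le_add_of_nonneg_left (norm_nonneg _))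

/-- **λ-lemma-type accumulation on the unstable manifold.** -/
theorem stmt_9 {s u : ℕ} (hs : 1 ≤ s) (hu : 1 ≤ u)
    (Lm : Matrix (Fin s) (Fin s) ℝ) (Lp : Matrix (Fin u) (Fin u) ℝ)
    (hLmsymm : Lm.IsSymm) (hLpsymm : Lp.IsSymm)
    (ft : EuclideanSpace ℝ (Fin s) × EuclideanSpace ℝ (Fin u) → Matrix (Fin s) (Fin s) ℝ)
    (gt : EuclideanSpace ℝ (Fin s) × EuclideanSpace ℝ (Fin u) → Matrix (Fin u) (Fin u) ℝ)
    (hft : ContDiff ℝ 1 fun p => matCLM (ft p))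
    (hgt : ContDiff ℝ 1 fun p => matCLM (gt p))
    (α δ ε : ℝ) (hδ : 0 ≤ δ) (hδα : δ < α) (hε : 0 < ε)
    (hLm : ∀ x : EuclideanSpace ℝ (Fin s), ⟪matCLM Lm x, x⟫_ℝ ≤ -α * ‖x‖ ^ 2)
    (hLp : ∀ y : EuclideanSpace ℝ (Fin u), α * ‖y‖ ^ 2 ≤ ⟪matCLM Lp y, y⟫_ℝ)
    (hftδ : ∀ x y, max ‖x‖ ‖y‖ ≤ 2 * ε → ‖matCLM (ft (x, y))‖ ≤ δ)
    (hgtδ : ∀ x y, max ‖x‖ ‖y‖ ≤ 2 * ε → ‖matCLM (gt (x, y))‖ ≤ δ)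
    (q : EuclideanSpace ℝ (Fin s)) (hq : ‖q‖ < ε)
    (r : EuclideanSpace ℝ (Fin u)) (hr : ‖r‖ < ε) :
    ∀ ε' : ℝ, 0 < ε' →
      ∃ (y' : ℕ → EuclideanSpace ℝ (Fin u))
        (xn : ℕ → EuclideanSpace ℝ (Fin s)) (yn : ℕ → EuclideanSpace ℝ (Fin u))
        (tn : ℕ → ℝ)
        (γx : ℕ → ℝ → EuclideanSpace ℝ (Fin s)) (γy : ℕ → ℝ → EuclideanSpace ℝ (Fin u)),
        (∀ n, ‖y' n‖ ≤ ε') ∧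
        Filter.Tendsto y' Filter.atTop (nhds 0) ∧
        (∀ n, max ‖xn n‖ ‖yn n‖ ≤ ε) ∧
        Filter.Tendsto (fun n => (xn n, yn n)) Filter.atTop (nhds (0, r)) ∧
        (∀ n, 0 ≤ tn n) ∧
        (∀ n, ∀ t ∈ Icc (0 : ℝ) (tn n),
          HasDerivWithinAt (γx n)
            (matCLM Lm (γx n t) + matCLM (ft (γx n t, γy n t)) (γx n t)) (Icc 0 (tn n)) t) ∧
        (∀ n, ∀ t ∈ Icc (0 : ℝ) (tn n),
          HasDerivWithinAt (γy n)
            (matCLM Lp (γy n t) + matCLM (gt (γx n t, γy n t)) (γy n t)) (Icc 0 (tn n)) t) ∧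
        (∀ n, ∀ t ∈ Icc (0 : ℝ) (tn n), max ‖γx n t‖ ‖γy n t‖ ≤ ε) ∧
        (∀ n, γx n 0 = q ∧ γy n 0 = y' n) ∧
        (∀ n, γx n (tn n) = xn n ∧ γy n (tn n) = yn n) := by
  intro ε' hε'
  obtain ⟨K₁, hK₁, hfK⟩ := exists_norm_sub_le_of_contDiff hft ε
  obtain ⟨K₂, hK₂, hgK⟩ := exists_norm_sub_le_of_contDiff hgt ε
  have hμ : 0 < α - δ := sub_pos.2 hδα
  have hK : 0 ≤ K₁ + K₂ := add_nonneg hK₁ hK₂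
  obtain ⟨κ, T₀, w, w', hκ, hκ1, hw, hw0, hwT⟩ := exists_weight hδ hδα hε.le hK
  have hdecay : Filter.Tendsto (fun T => ε * Real.exp (-(α - δ) * T)) Filter.atTop (nhds 0) := by
    have h1 := Real.tendsto_exp_neg_atTop_nhds_zero.comp
      (Filter.tendsto_id.const_mul_atTop hμ)
    have h2 := h1.const_mul ε
    rw [mul_zero] at h2
    exact h2.congr fun T => by simp only [Function.comp_apply, id, neg_mul]
  obtain ⟨T₁, hT₁⟩ := Filter.eventually_atTop.1 (hdecay.eventually (ge_mem_nhds hε'))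
  obtain ⟨T, hT⟩ : ∃ T : ℕ → ℝ, T = fun n : ℕ => max 0 (max T₀ T₁) + (n : ℝ) := ⟨_, rfl⟩
  have hTn : ∀ n, max 0 (max T₀ T₁) ≤ T n := fun n => by
    rw [hT]; exact le_add_of_nonneg_right n.cast_nonneg
  have hT0 : ∀ n, 0 ≤ T n := fun n => (le_max_left _ _).trans (hTn n)
  have hTlim : Filter.Tendsto (fun n => ε * Real.exp (-(α - δ) * T n)) Filter.atTop (nhds 0) :=
    hdecay.comp (hT ▸ Filter.tendsto_atTop_add_const_left _ _ tendsto_natCast_atTop_atTop)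
  let f : C(EuclideanSpace ℝ (Fin s) × EuclideanSpace ℝ (Fin u),
      EuclideanSpace ℝ (Fin s) →L[ℝ] EuclideanSpace ℝ (Fin s)) :=
    ⟨fun p => matCLM (ft p), hft.continuous⟩
  let g : C(EuclideanSpace ℝ (Fin u) × EuclideanSpace ℝ (Fin s),
      EuclideanSpace ℝ (Fin u) →L[ℝ] EuclideanSpace ℝ (Fin u)) :=
    ⟨fun p => -matCLM (gt p.swap), (hgt.continuous.comp continuous_swap).neg⟩
  have hcube : ∀ {x : EuclideanSpace ℝ (Fin s)} {y : EuclideanSpace ℝ (Fin u)},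
      ‖x‖ ≤ ε → ‖y‖ ≤ ε → max ‖x‖ ‖y‖ ≤ 2 * ε := fun hx hy =>
    (max_le hx hy).trans (by linarith)
  choose U V hU0 hV0 hU hV hUb hVb using fun n =>
    exists_boundaryValue_solution (hT0 n) (A := matCLM Lm) (B := -matCLM Lp) (q := q) (r := r)
      (f := f) (g := g) hδ hδα hε.le hK hκ hκ1 hLm
      (fun y => by
        have := hLp y
        simp only [neg_apply, inner_neg_left]
        linarith)
      (fun x y hx hy => hftδ x y (hcube hx hy))
      (fun y x hy hx => by simpa [g] using hgtδ x y (hcube hx hy))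
      (fun x y x' y' hx hy hx' hy' => (hfK x y x' y' hx hy hx' hy').trans
        (mul_le_mul_of_nonneg_right (by linarith) (by positivity)))
      (fun y x y' x' hy hx hy' hx' => by
        have h := hgK x y x' y' hx hy hx' hy'
        have hg : g (y, x) - g (y', x') = -(matCLM (gt (x, y)) - matCLM (gt (x', y'))) := by
          simp [g]; abel
        rw [hg, norm_neg, add_comm ‖y - y'‖]
        exact h.trans (mul_le_mul_of_nonneg_right (by linarith) (by positivity)))
      hw hw0
      (hwT (T n) ((le_max_left _ _).trans ((le_max_right _ _).trans (hTn n)))) hq.le hr.le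
  have hle : ∀ t, 0 ≤ t → ε * Real.exp (-(α - δ) * t) ≤ ε := fun t ht =>
    mul_le_of_le_one_right hε.le (Real.exp_le_one_iff.2 (by nlinarith))
  have hmem : ∀ n, T n ∈ Icc 0 (T n) := fun n => ⟨hT0 n, le_rfl⟩
  have hbox : ∀ n, ∀ t ∈ Icc (0 : ℝ) (T n), max ‖U n t‖ ‖V n (T n - t)‖ ≤ ε := fun n t ht =>
    max_le ((hUb n t ht).trans (hle t ht.1))
      ((hVb n _ (sub_mem_Icc_zero ht)).trans (hle _ (sub_mem_Icc_zero ht).1))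
  have hUlim : Filter.Tendsto (fun n => U n (T n)) Filter.atTop (nhds 0) :=
    squeeze_zero_norm (fun n => hUb n _ (hmem n)) hTlim
  have hVlim : Filter.Tendsto (fun n => V n (T n)) Filter.atTop (nhds 0) :=
    squeeze_zero_norm (fun n => hVb n _ (hmem n)) hTlim
  refine ⟨fun n => V n (T n), fun n => U n (T n), fun _ => r, T, U, fun n t => V n (T n - t),
    fun n => ?_, hVlim, fun n => ?_, hUlim.prodMk_nhds tendsto_const_nhds, hT0,
    fun n t ht => (hU n t ht).hasDerivWithinAt, fun n t ht => ?_, hbox,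
    fun n => ⟨hU0 n, by simp⟩, fun n => ⟨rfl, by simp [hV0]⟩⟩
  · exact (hVb n _ (hmem n)).trans
      (hT₁ _ ((le_max_right _ _).trans ((le_max_right _ _).trans (hTn n))))
  · simpa [hV0] using hbox n _ (hmem n)
  · have h := (hV n _ (sub_mem_Icc_zero ht)).scomp t ((hasDerivAt_id t).const_sub (T n))
    refine (h.congr_deriv ?_).hasDerivWithinAt
    simp [g]
end

section
/- Odd-power expansion identity: Let R be a (not necessarily commutative) ring and let B, C, C₁ ∈ R satisfy: C² = 0, C₁² = 0, C·C₁ = 0, C₁·C = 0, B²·C = C·B², B²·C₁ = C₁·B², B·C·B = B²·C₁, C₁·B·C = 0, C·B·C₁ = 0, and C·B·C = 0. Set ω := C + B. Then for every integer j ≥ 1: ω^{2j−1} = B^{2j−2}·(j·C + (j−1)·C₁) + B^{2j−1}, where j· denotes the natural number scalar multiple. -/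
/-- **Odd-power expansion identity:** with `ω = C + B` and the listed relations,
`ω^{2j−1} = B^{2j−2} (j•C + (j−1)•C₁) + B^{2j−1}` for all `j ≥ 1`. -/
theorem stmt_16 {R : Type*} [Ring R] (B C C₁ : R)
    (hC : C ^ 2 = 0) (hC₁ : C₁ ^ 2 = 0)
    (hCC₁ : C * C₁ = 0) (hC₁C : C₁ * C = 0)
    (hB2C : B ^ 2 * C = C * B ^ 2) (hB2C₁ : B ^ 2 * C₁ = C₁ * B ^ 2)
    (hBCB : B * C * B = B ^ 2 * C₁)
    (hC₁BC : C₁ * B * C = 0) (hCBC₁ : C * B * C₁ = 0) (hCBC : C * B * C = 0) :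
    ∀ j : ℕ, 1 ≤ j →
      (C + B) ^ (2 * j - 1) =
        B ^ (2 * j - 2) * (j • C + (j - 1) • C₁) + B ^ (2 * j - 1) := by
  have hω : (C + B) ^ 2 = C * B + B * C + B ^ 2 := by
    rw [sq, add_mul, mul_add, mul_add, ← sq, ← sq, hC]
    abel
  have hC_mul : C * (C + B) ^ 2 = B ^ 2 * C := by
    rw [hω, mul_add, mul_add, ← mul_assoc, ← mul_assoc, ← sq, hC, hCBC, hB2C]
    simp
  have hC₁_mul : C₁ * (C + B) ^ 2 = B ^ 2 * C₁ := by
    rw [hω, mul_add, mul_add, ← mul_assoc, ← mul_assoc, hC₁C, hC₁BC, hB2C₁]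
    simp
  have hB_mul : B * (C + B) ^ 2 = B ^ 2 * (C + C₁ + B) := by
    rw [hω, mul_add, mul_add, ← mul_assoc, hBCB]
    noncomm_ring
  have key (n : ℕ) :
      (C + B) ^ (2 * n + 1) = B ^ (2 * n) * ((n + 1) • C + n • C₁ + B) := by
    induction n with
    | zero => simp
    | succ n ih =>
      rw [show 2 * (n + 1) + 1 = 2 * n + 1 + 2 by ring, pow_add, ih, mul_assoc, add_mul,
        add_mul, smul_mul_assoc, smul_mul_assoc, hC_mul, hC₁_mul, hB_mul,
        show 2 * (n + 1) = 2 * n + 2 by ring, pow_add B, mul_assoc, ← mul_smul_comm,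
        ← mul_smul_comm, ← mul_add, ← mul_add]
      congr 2
      simp only [add_smul, one_smul]
      abel
  intro j hj
  obtain ⟨n, rfl⟩ := Nat.exists_eq_add_of_le' hj
  rw [show 2 * (n + 1) - 1 = 2 * n + 1 by omega, show 2 * (n + 1) - 2 = 2 * n by omega,
    Nat.add_sub_cancel, key, mul_add, pow_succ]
end

section
/- Critical points of U ↦ Re Tr(AU) on the unitary group are diagonal reflections: Let n ≥ 1 and let A be the n×n real (hence complex) diagonal matrix with diagonal entries a₁, …, aₙ which are strictly positive and pairwise distinct (e.g. aᵢ = i). Then a unitary matrix U ∈ U(n) satisfies U·A·U = A if and only if U is a diagonal matrix all of whose diagonal entries belong to {1, −1}. -/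
/-- **Critical points of `U ↦ Re Tr(AU)` on the unitary group are diagonal reflections.**
For `A = diag(a₁, …, aₙ)` with the `aᵢ` strictly positive and pairwise distinct, a unitary
matrix `U` satisfies `U A U = A` iff `U` is diagonal with diagonal entries in `{1, −1}`. -/
theorem stmt_17 {n : ℕ} (hn : 1 ≤ n) (a : Fin n → ℝ)
    (hapos : ∀ i, 0 < a i) (hainj : Function.Injective a)
    (U : Matrix (Fin n) (Fin n) ℂ) (hU : U ∈ Matrix.unitaryGroup (Fin n) ℂ) :
    U * Matrix.diagonal (fun i => (a i : ℂ)) * U = Matrix.diagonal (fun i => (a i : ℂ)) ↔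
      ∃ d : Fin n → ℂ, (∀ i, d i = 1 ∨ d i = -1) ∧ U = Matrix.diagonal d := by
  have hane : ∀ i, (a i : ℂ) ≠ 0 := fun i => by exact_mod_cast (hapos i).ne'
  constructor
  · intro h
    set A : Matrix (Fin n) (Fin n) ℂ := Matrix.diagonal (fun i => (a i : ℂ)) with hA
    have hUU : U * star U = 1 := (Matrix.mem_unitaryGroup_iff).1 hU
    have hUU' : star U * U = 1 := (Matrix.mem_unitaryGroup_iff').1 hU
    have hr : U * A = A * star U := by
      calc U * A = U * A * U * star U := by rw [mul_assoc (U * A), hUU, mul_one]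
        _ = A * star U := by rw [h]
    have hl : A * U = star U * A := by
      calc A * U = star U * (U * A * U) := by
            rw [mul_assoc U, ← mul_assoc (star U), hUU', one_mul]
        _ = star U * A := by rw [h]
    have hcomm : U * (A * A) = A * A * U := by
      rw [← mul_assoc, hr, mul_assoc, ← hl, mul_assoc]
    have hoff : ∀ i j, i ≠ j → U i j = 0 := by
      intro i j hij
      have hij' := congrFun (congrFun hcomm i) j
      rw [hA, Matrix.diagonal_mul_diagonal, Matrix.mul_diagonal, Matrix.diagonal_mul] at hij'
      by_contra hne
      have hsq : (a j : ℂ) * a j = a i * a i :=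
        mul_left_cancel₀ hne (hij'.trans (mul_comm _ _))
      have hsq' : a j * a j = a i * a i := by exact_mod_cast hsq
      exact hij (hainj ((mul_self_inj (hapos j).le (hapos i).le).1 hsq').symm)
    have hdiag : U = Matrix.diagonal fun i => U i i := by
      ext i j
      by_cases hij : i = j
      · subst hij
        simp
      · rw [Matrix.diagonal_apply_ne _ hij, hoff i j hij]
    refine ⟨fun i => U i i, fun i => ?_, hdiag⟩
    rw [hdiag, hA, Matrix.diagonal_mul_diagonal, Matrix.diagonal_mul_diagonal] at h
    have hi := congrFun (Matrix.diagonal_injective h) i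
    apply mul_self_eq_one_iff.1
    apply mul_right_cancel₀ (hane i)
    rw [one_mul, mul_right_comm]
    exact hi
  · rintro ⟨d, hd, rfl⟩
    rw [Matrix.diagonal_mul_diagonal, Matrix.diagonal_mul_diagonal]
    congr 1
    funext i
    rcases hd i with h | h <;> simp [h]
end
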